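/- arXiv:2306.13077 — 3 statements merged into one kernel-verified Lean document; each statement's English description precedes it below -/
import Mathlib

section
/- Let Δ ∈ ℕ and let (G_n) be a sequence of finite connected simple graphs with all vertex degrees at most Δ and |V_n| → ∞. If the simple random walks on (G_n) exhibit cutoff, then the lazy random walks on (G_n) also exhibit cutoff. -/
open Filter

noncomputable section

/-- A perfect matching of a vertex set: a fixed-point-free involution. -/
def IsPerfectMatchingFn {V : Type*} (η : V → V) : Prop :=
  Function.Involutive η ∧ ∀ x, η x ≠ x

/-- Probability that a uniformly random perfect matching satisfies the event `E`. -/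
noncomputable def matchingProb (V : Type*) (E : (V → V) → Prop) : ℝ :=
  (Nat.card {η : V → V // IsPerfectMatchingFn η ∧ E η} : ℝ) /
    (Nat.card {η : V → V // IsPerfectMatchingFn η} : ℝ)

/-- Transition matrix of the simple random walk on a finite graph. -/
noncomputable def srwMatrix {V : Type*} [Fintype V] (G : SimpleGraph V) [DecidableRel G.Adj] :
    Matrix V V ℝ :=
  fun x y => if G.Adj x y then ((G.degree x : ℝ))⁻¹ else 0

/-- Stationary distribution of the simple random walk: `deg x / (2|E|)`. -/
noncomputable def srwPi {V : Type*} [Fintype V] [DecidableEq V] (G : SimpleGraph V)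
    [DecidableRel G.Adj] : V → ℝ :=
  fun x => (G.degree x : ℝ) / (2 * G.edgeFinset.card)

/-- The lazy version `(I + P)/2` of a transition matrix `P`. -/
noncomputable def lazyMatrix {V : Type*} [Fintype V] [DecidableEq V] (P : Matrix V V ℝ) :
    Matrix V V ℝ :=
  (2 : ℝ)⁻¹ • (1 + P)

/-- Transition matrix of the random walk on the weighted graph `G*` obtained from `G`
by adding the matching edges `{x, η x}` with weight `ε`. -/
noncomputable def starMatrix {V : Type*} [Fintype V] [DecidableEq V] (G : SimpleGraph V)
    [DecidableRel G.Adj] (η : V → V) (ε : ℝ) : Matrix V V ℝ :=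
  fun x y => ((if G.Adj x y then (1 : ℝ) else 0) + ε * (if η x = y then 1 else 0)) /
    ((G.degree x : ℝ) + ε)

/-- Stationary distribution of the random walk on `G*`. -/
noncomputable def starPi {V : Type*} [Fintype V] [DecidableEq V] (G : SimpleGraph V)
    [DecidableRel G.Adj] (ε : ℝ) : V → ℝ :=
  fun x => ((G.degree x : ℝ) + ε) / (2 * G.edgeFinset.card + ε * Fintype.card V)

/-- The chain with transition matrix `P` and stationary distribution `stat` is mixed within
total variation distance `θ` from every starting state at time `t`. -/
def mixedAt {V : Type*} [Fintype V] [DecidableEq V] (P : Matrix V V ℝ) (stat : V → ℝ)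
    (θ : ℝ) (t : ℕ) : Prop :=
  ∀ x, (2 : ℝ)⁻¹ * ∑ y, |(P ^ t) x y - stat y| ≤ θ

/-- Total variation mixing time (`sInf` over `ℕ`, so `0` if the chain never mixes). -/
noncomputable def tmix {V : Type*} [Fintype V] [DecidableEq V] (P : Matrix V V ℝ)
    (stat : V → ℝ) (θ : ℝ) : ℕ :=
  sInf {t | mixedAt P stat θ t}

/-- Entropy of a probability vector. -/
noncomputable def entropy {V : Type*} [Fintype V] (p : V → ℝ) : ℝ :=
  ∑ y, Real.negMulLog (p y)

/-- A family of Markov chains indexed by `n`, with mixing-time function `tm n θ`,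
exhibits cutoff. -/
def hasCutoff (tm : ℕ → ℝ → ℕ) : Prop :=
  ∃ t s : ℕ → ℝ, (∀ n, 0 < t n) ∧ (∀ n, 0 ≤ s n) ∧
    Tendsto (fun n => s n / t n) atTop (nhds 0) ∧
    ∀ θ ∈ Set.Ioo (0 : ℝ) 1, ∃ c : ℝ,
      ∀ n, t n - c * s n ≤ (tm n θ : ℝ) ∧ (tm n θ : ℝ) ≤ t n + c * s n

/-- Number of vertices within graph distance `s` of `o`. -/
noncomputable def ballCard {V : Type*} (G : SimpleGraph V) (o : V) (s : ℝ) : ℕ :=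
  Nat.card {y : V | (G.dist o y : ℝ) ≤ s}

/-- A vertex-transitive graph. -/
def IsVertexTransitive {V : Type*} (G : SimpleGraph V) : Prop :=
  ∀ x y : V, ∃ φ : G ≃g G, φ x = y


/-- The probability that a binomial variable with parameters `n`, `p` takes the value `i`. -/
def binomialWeight (n : ℕ) (p : ℝ) (i : ℕ) : ℝ :=
  n.choose i * p ^ i * (1 - p) ^ (n - i)

lemma binomialWeight_nonneg {p : ℝ} (hp0 : 0 ≤ p) (hp1 : p ≤ 1) (n i : ℕ) :
    0 ≤ binomialWeight n p i := by
  have : 0 ≤ 1 - p := by linarith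
  unfold binomialWeight
  positivity

lemma sum_binomialWeight (n : ℕ) (p : ℝ) :
    ∑ i ∈ Finset.range (n + 1), binomialWeight n p i = 1 := by
  have h := add_pow p (1 - p) n
  rw [add_sub_cancel, one_pow] at h
  rw [h]
  exact Finset.sum_congr rfl fun i _ => by unfold binomialWeight; ring

lemma binomialWeight_variance (n : ℕ) (p : ℝ) :
    ∑ i ∈ Finset.range (n + 1), (n * p - i) ^ 2 * binomialWeight n p i = n * p * (1 - p) := by
  have h := congrArg (Polynomial.eval p) (bernsteinPolynomial.variance (R := ℝ) n)
  simpa [Polynomial.eval_finsetSum, bernsteinPolynomial, binomialWeight] using h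

/-- Chebyshev's inequality for the binomial distribution. -/
lemma sum_binomialWeight_le_of_far {n : ℕ} {p a : ℝ} (hp0 : 0 ≤ p) (hp1 : p ≤ 1) (ha : 0 < a)
    (S : Finset ℕ) (hS : S ⊆ Finset.range (n + 1)) (hfar : ∀ i ∈ S, a ≤ |n * p - i|) :
    ∑ i ∈ S, binomialWeight n p i ≤ n * p * (1 - p) / a ^ 2 := by
  rw [le_div_iff₀ (by positivity), Finset.sum_mul, ← binomialWeight_variance]
  refine (Finset.sum_le_sum fun i hi => ?_).trans
    (Finset.sum_le_sum_of_subset_of_nonneg hS fun i _ _ =>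
      mul_nonneg (sq_nonneg _) (binomialWeight_nonneg hp0 hp1 n i))
  rw [mul_comm, ← sq_abs (n * p - i)]
  have := binomialWeight_nonneg hp0 hp1 n i
  gcongr
  exact hfar i hi

lemma sum_abs_mul_binomialWeight_le {p : ℝ} (hp0 : 0 ≤ p) (hp1 : p ≤ 1) (n : ℕ) :
    ∑ i ∈ Finset.range (n + 1), |n * p - i| * binomialWeight n p i ≤ √(n * p * (1 - p)) := by
  apply Real.le_sqrt_of_sq_le
  rw [← binomialWeight_variance]
  have h := Finset.sum_mul_sq_le_sq_mul_sq (Finset.range (n + 1))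
    (fun i : ℕ => |n * p - i| * √(binomialWeight n p i)) (fun i => √(binomialWeight n p i))
  have hs : ∀ i, √(binomialWeight n p i) * √(binomialWeight n p i) = binomialWeight n p i :=
    fun i => Real.mul_self_sqrt (binomialWeight_nonneg hp0 hp1 n i)
  simp only [mul_assoc, hs, mul_pow, sq_abs, Real.sq_sqrt (binomialWeight_nonneg hp0 hp1 n _),
    sum_binomialWeight, mul_one] at h
  exact h

lemma binomialWeight_succ_mul (n i : ℕ) (p : ℝ) (hi : i ≤ n + 1) :
    ((n + 1 : ℕ) - i : ℝ) * binomialWeight (n + 1) p i =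
      (n + 1 : ℕ) * (1 - p) * binomialWeight n p i := by
  unfold binomialWeight
  rcases hi.lt_or_eq with hlt | rfl
  · have h := Nat.choose_mul_succ_eq n i
    have h' : (n.choose i : ℝ) * (n + 1 : ℕ) = (n + 1).choose i * ((n + 1 : ℕ) - i : ℝ) := by
      rw [← Nat.cast_sub hi]; exact_mod_cast h
    have h2 : n + 1 - i = (n - i) + 1 := by omega
    rw [h2, pow_succ]
    linear_combination (-(p ^ i * (1 - p) ^ (n - i) * (1 - p))) * h'
  · simp

lemma binomialWeight_succ_succ_mul (n i : ℕ) (p : ℝ) :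
    ((i + 1 : ℕ) : ℝ) * binomialWeight (n + 1) p (i + 1) =
      (n + 1 : ℕ) * p * binomialWeight n p i := by
  unfold binomialWeight
  have h : ((n + 1 : ℕ) : ℝ) * n.choose i = (n + 1).choose (i + 1) * (i + 1 : ℕ) := by
    exact_mod_cast Nat.add_one_mul_choose_eq n i
  rw [Nat.add_sub_add_right, pow_succ]
  linear_combination (-(p ^ i * (1 - p) ^ (n - i) * p)) * h

section Smoothing

variable {A : Type*} [NormedRing A] [NormedAlgebra ℝ A]

lemma lazy_pow_eq_sum (R : A) (p : ℝ) (n : ℕ) :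
    ((1 - p) • 1 + p • R) ^ n = ∑ i ∈ Finset.range (n + 1), binomialWeight n p i • R ^ i := by
  have hc : Commute (p • R) ((1 - p) • (1 : A)) :=
    ((Commute.one_right R).smul_left p).smul_right (1 - p)
  rw [add_comm, hc.add_pow]
  refine Finset.sum_congr rfl fun i _ => ?_
  rw [smul_pow, smul_pow, one_pow, ← nsmul_eq_mul', smul_mul_smul_comm, mul_one,
    ← Nat.cast_smul_eq_nsmul ℝ, smul_smul, binomialWeight]
  congr 1
  ring

/-- Powers of a lazy contraction vary slowly. -/
lemma norm_lazy_pow_mul_one_sub_le (R : A) (hR : ∀ i, ‖R ^ i‖ ≤ 1) {p : ℝ} (hp0 : 0 < p)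
    (hp1 : p < 1) (n : ℕ) :
    ‖((1 - p) • 1 + p • R) ^ n * (1 - R)‖ ≤ (√((n + 1 : ℕ) * p * (1 - p)))⁻¹ := by
  have hq : 0 < 1 - p := by linarith
  set v : ℝ := (n + 1 : ℕ) * p * (1 - p) with hv
  have hvpos : 0 < v := by positivity
  have key : v • (((1 - p) • 1 + p • R) ^ n * (1 - R)) =
      ∑ i ∈ Finset.range (n + 2),
        (((n + 1 : ℕ) * p - i) * binomialWeight (n + 1) p i) • R ^ i := by
    have hterm : ∀ i ∈ Finset.range (n + 2),
        (((n + 1 : ℕ) * p - i) * binomialWeight (n + 1) p i) • R ^ i =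
          (v * binomialWeight n p i) • R ^ i -
            ((1 - p) * (i * binomialWeight (n + 1) p i)) • R ^ i := by
      intro i hi
      rw [← sub_smul]
      congr 1
      have := binomialWeight_succ_mul n i p (by simp at hi; omega)
      rw [hv]
      linear_combination p * this
    rw [Finset.sum_congr rfl hterm, Finset.sum_sub_distrib, Finset.sum_range_succ,
      Finset.sum_range_succ' (fun i : ℕ => ((1 - p) * (i * binomialWeight (n + 1) p i)) • R ^ i)]
    have h0 : binomialWeight n p (n + 1) = 0 := by simp [binomialWeight]
    have h1 : ∀ i : ℕ, (1 - p) * (((i + 1 : ℕ) : ℝ) * binomialWeight (n + 1) p (i + 1)) =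
        v * binomialWeight n p i := fun i => by
      rw [binomialWeight_succ_succ_mul, hv]; ring
    simp only [h1, h0]
    rw [lazy_pow_eq_sum, mul_sub, mul_one, Finset.sum_mul, smul_sub, Finset.smul_sum,
      Finset.smul_sum]
    simp [smul_smul, pow_succ]
  have hnorm : v * ‖((1 - p) • 1 + p • R) ^ n * (1 - R)‖ ≤ √v := by
    rw [← abs_of_pos hvpos, ← Real.norm_eq_abs, ← norm_smul, key, Real.norm_of_nonneg hvpos.le]
    refine (norm_sum_le _ _).trans (le_trans (Finset.sum_le_sum fun i _ => ?_)
      (sum_abs_mul_binomialWeight_le hp0.le hp1.le (n + 1)))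
    rw [norm_smul, norm_mul, Real.norm_eq_abs,
      Real.norm_of_nonneg (binomialWeight_nonneg hp0.le hp1.le _ _)]
    exact mul_le_of_le_one_right
      (mul_nonneg (abs_nonneg _) (binomialWeight_nonneg hp0.le hp1.le _ _)) (hR i)
  have hs : 0 < √v := Real.sqrt_pos.2 hvpos
  rw [← one_div, le_div_iff₀ hs]
  have h2 : √v * √v = v := Real.mul_self_sqrt hvpos.le
  nlinarith

end Smoothing

section Chains

open Matrix

variable {V : Type*} [Fintype V]

lemma sum_le_half_sum_abs [DecidableEq V] (d : V → ℝ) (hd : ∑ y, d y = 0) (A : Finset V) :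
    ∑ y ∈ A, d y ≤ 2⁻¹ * ∑ y, |d y| := by
  have h1 : ∑ y ∈ A, d y ≤ ∑ y ∈ A, |d y| := Finset.sum_le_sum fun y _ => le_abs_self _
  have h2 : -∑ y ∈ Aᶜ, d y ≤ ∑ y ∈ Aᶜ, |d y| := by
    rw [← Finset.sum_neg_distrib]
    exact Finset.sum_le_sum fun y _ => neg_le_abs _
  have h3 := Finset.sum_add_sum_compl A d
  have h4 := Finset.sum_add_sum_compl A fun y => |d y|
  linarith

lemma half_sum_abs_eq_sum_pos (d : V → ℝ) (hd : ∑ y, d y = 0) :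
    2⁻¹ * ∑ y, |d y| = ∑ y with 0 < d y, d y := by
  have h1 : ∑ y with 0 < d y, |d y| = ∑ y with 0 < d y, d y :=
    Finset.sum_congr rfl fun y hy => abs_of_pos (Finset.mem_filter.1 hy).2
  have h2 : ∑ y with ¬ 0 < d y, |d y| = -∑ y with ¬ 0 < d y, d y := by
    rw [← Finset.sum_neg_distrib]
    exact Finset.sum_congr rfl fun y hy => abs_of_nonpos (not_lt.1 (Finset.mem_filter.1 hy).2)
  have h3 := Finset.sum_filter_add_sum_filter_not Finset.univ (fun y => 0 < d y) d
  have h4 := Finset.sum_filter_add_sum_filter_not Finset.univ (fun y => 0 < d y) fun y => |d y|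
  linarith

variable [DecidableEq V]

lemma sum_abs_vecMul_le {M : Matrix V V ℝ} (hM : M ∈ rowStochastic ℝ V) (v : V → ℝ) :
    ∑ y, |(v ᵥ* M) y| ≤ ∑ y, |v y| := by
  calc ∑ y, |(v ᵥ* M) y| ≤ ∑ y, ∑ z, |v z| * M z y := by
        refine Finset.sum_le_sum fun y _ => ?_
        refine (Finset.abs_sum_le_sum_abs _ _).trans (Finset.sum_le_sum fun z _ => ?_)
        rw [abs_mul, abs_of_nonneg (nonneg_of_mem_rowStochastic hM)]
    _ = ∑ y, |v y| := by
        rw [Finset.sum_comm]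
        simp [← Finset.mul_sum, sum_row_of_mem_rowStochastic hM]

lemma sum_abs_pow_sub_antitone {P : Matrix V V ℝ} (hP : P ∈ rowStochastic ℝ V) {stat : V → ℝ}
    (hstat : stat ᵥ* P = stat) (x : V) {k K : ℕ} (hk : k ≤ K) :
    ∑ y, |(P ^ K) x y - stat y| ≤ ∑ y, |(P ^ k) x y - stat y| := by
  have hfix : ∀ m : ℕ, stat ᵥ* P ^ m = stat := fun m => by
    induction m with
    | zero => simp
    | succ m ih => rw [pow_succ, ← vecMul_vecMul, ih, hstat]
  have h := sum_abs_vecMul_le (pow_mem hP (K - k)) (fun y => (P ^ k) x y - stat y)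
  have h2 : (fun y => (P ^ k) x y - stat y) ᵥ* P ^ (K - k) = fun y => (P ^ K) x y - stat y := by
    have : (fun y => (P ^ k) x y - stat y) = (P ^ k) x - stat := rfl
    rw [this, sub_vecMul, hfix]
    funext y
    rw [Pi.sub_apply, ← mul_apply_eq_vecMul, ← pow_add, Nat.add_sub_cancel' hk]
  rwa [h2] at h

lemma lazyMatrix_mem_rowStochastic {P : Matrix V V ℝ} (hP : P ∈ rowStochastic ℝ V) :
    lazyMatrix P ∈ rowStochastic ℝ V := by
  have h := convex_rowStochastic (R := ℝ) (n := V) (one_mem _) hP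
    (show (0 : ℝ) ≤ 2⁻¹ by norm_num) (show (0 : ℝ) ≤ 2⁻¹ by norm_num) (by norm_num)
  rwa [← smul_add] at h

attribute [local instance] Matrix.linftyOpNormedRing Matrix.linftyOpNormedAlgebra

lemma linftyOpNorm_le_iff (M : Matrix V V ℝ) {c : ℝ} (hc : 0 ≤ c) :
    ‖M‖ ≤ c ↔ ∀ x, ∑ y, |M x y| ≤ c := by
  lift c to NNReal using hc
  rw [linfty_opNorm_def, NNReal.coe_le_coe, Finset.sup_le_iff]
  simp only [Finset.mem_univ, true_implies, ← NNReal.coe_le_coe, NNReal.coe_sum, coe_nnnorm,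
    Real.norm_eq_abs]

lemma sum_abs_le_linftyOpNorm (M : Matrix V V ℝ) (x : V) : ∑ y, |M x y| ≤ ‖M‖ :=
  (linftyOpNorm_le_iff M (norm_nonneg M)).1 le_rfl x

lemma linftyOpNorm_le_one {M : Matrix V V ℝ} (hM : M ∈ rowStochastic ℝ V) : ‖M‖ ≤ 1 := by
  refine (linftyOpNorm_le_iff M zero_le_one).2 fun x => ?_
  rw [← sum_row_of_mem_rowStochastic hM x]
  exact (Finset.sum_congr rfl fun y _ => abs_of_nonneg (nonneg_of_mem_rowStochastic hM)).le

lemma mixedAt_iff_norm_le (P : Matrix V V ℝ) (stat : V → ℝ) {θ : ℝ} (hθ : 0 ≤ θ) (t : ℕ) :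
    mixedAt P stat θ t ↔ ‖P ^ t - of fun _ => stat‖ ≤ 2 * θ := by
  rw [linftyOpNorm_le_iff _ (by positivity)]
  refine forall_congr' fun x => ?_
  rw [inv_mul_le_iff₀ two_pos]
  rfl

lemma rowStochastic_mul_const {M : Matrix V V ℝ} (hM : M ∈ rowStochastic ℝ V) (stat : V → ℝ) :
    (M * of fun _ => stat) = of fun _ => stat := by
  ext x y
  simp [mul_apply, ← Finset.sum_mul, sum_row_of_mem_rowStochastic hM]

lemma norm_pow_sub_const_antitone {P : Matrix V V ℝ} (hP : P ∈ rowStochastic ℝ V)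
    (stat : V → ℝ) : Antitone fun t : ℕ => ‖P ^ t - of fun _ => stat‖ := by
  intro s t hst
  have h : P ^ t - (of fun _ => stat) = P ^ (t - s) * (P ^ s - of fun _ => stat) := by
    rw [mul_sub, rowStochastic_mul_const (pow_mem hP _), ← pow_add, Nat.sub_add_cancel hst]
  dsimp only
  rw [h]
  exact (norm_mul_le _ _).trans
    (mul_le_of_le_one_left (norm_nonneg _) (linftyOpNorm_le_one (pow_mem hP _)))

lemma mixedAt.mono {P : Matrix V V ℝ} (hP : P ∈ rowStochastic ℝ V) {stat : V → ℝ} {θ : ℝ}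
    (hθ : 0 ≤ θ) {s t : ℕ} (h : mixedAt P stat θ s) (hst : s ≤ t) : mixedAt P stat θ t := by
  rw [mixedAt_iff_norm_le P stat hθ] at h ⊢
  exact (norm_pow_sub_const_antitone hP stat hst).trans h

lemma lazyMatrix_pow_eq_sum (P : Matrix V V ℝ) (T : ℕ) :
    lazyMatrix P ^ T = ∑ k ∈ Finset.range (T + 1), binomialWeight T 2⁻¹ k • P ^ k := by
  rw [← lazy_pow_eq_sum, lazyMatrix, smul_add]
  norm_num

lemma lazyMatrix_pow_sub_eq_sum (T : ℕ) (P C : Matrix V V ℝ) :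
    lazyMatrix P ^ T - C = ∑ k ∈ Finset.range (T + 1), binomialWeight T 2⁻¹ k • (P ^ k - C) := by
  simp only [smul_sub, Finset.sum_sub_distrib, ← Finset.sum_smul, sum_binomialWeight, one_smul,
    lazyMatrix_pow_eq_sum]

/-- If the chain is mixed at time `m`, then the lazy chain is mixed at times `T` with
`T / 2` slightly larger than `m`. -/
lemma mixedAt_lazyMatrix {P : Matrix V V ℝ} (hP : P ∈ rowStochastic ℝ V) {stat : V → ℝ}
    (hpos : ∀ y, 0 ≤ stat y) (hsum : ∑ y, stat y = 1) {θ a : ℝ} (hθ : 0 ≤ θ) (ha : 0 < a)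
    {m T : ℕ} (hm : mixedAt P stat θ m) (hT : (m : ℝ) + a ≤ T / 2) :
    mixedAt (lazyMatrix P) stat (θ + T / 4 / a ^ 2) T := by
  have hC : (of fun _ => stat : Matrix V V ℝ) ∈ rowStochastic ℝ V :=
    mem_rowStochastic_iff_sum.2 ⟨fun _ => hpos, fun _ => hsum⟩
  have hb : ∀ k, 0 ≤ binomialWeight T 2⁻¹ k :=
    binomialWeight_nonneg (by norm_num) (by norm_num) T
  have hfar := sum_binomialWeight_le_of_far (n := T) (p := 2⁻¹) (by norm_num) (by norm_num) ha
    ((Finset.range (T + 1)).filter fun k => k < m) (Finset.filter_subset _ _) (by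
      intro k hk
      have : (k : ℝ) < m := by exact_mod_cast (Finset.mem_filter.1 hk).2
      exact le_trans (by linarith) (le_abs_self _))
  rw [mixedAt_iff_norm_le _ _ (by positivity), lazyMatrix_pow_sub_eq_sum]
  refine (norm_sum_le _ _).trans ?_
  have hterm : ∀ k ∈ Finset.range (T + 1),
      ‖binomialWeight T 2⁻¹ k • (P ^ k - of fun _ => stat)‖ ≤
        binomialWeight T 2⁻¹ k * (2 * θ) + if k < m then binomialWeight T 2⁻¹ k * 2 else 0 := by
    intro k _
    rw [norm_smul, Real.norm_of_nonneg (hb k)]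
    split_ifs with hk
    · have h2 : ‖P ^ k - of fun _ => stat‖ ≤ 2 := (norm_sub_le _ _).trans (by
        linarith [linftyOpNorm_le_one (pow_mem hP k), linftyOpNorm_le_one hC])
      nlinarith [hb k, mul_le_mul_of_nonneg_left h2 (hb k), mul_nonneg (hb k) hθ]
    · rw [add_zero]
      exact mul_le_mul_of_nonneg_left
        ((mixedAt_iff_norm_le _ _ hθ _).1 (hm.mono hP hθ (not_lt.1 hk))) (hb k)
  refine (Finset.sum_le_sum hterm).trans ?_
  rw [Finset.sum_add_distrib, ← Finset.sum_mul, sum_binomialWeight, ← Finset.sum_filter,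
    ← Finset.sum_mul]
  have : (T : ℝ) * 2⁻¹ * (1 - 2⁻¹) / a ^ 2 = T / 4 / a ^ 2 := by ring
  linarith

/-- If the two-step chain has holding probability at least `δ`, then its powers vary slowly. -/
lemma norm_pow_add_two_mul_sub_le {P : Matrix V V ℝ} (hP : P ∈ rowStochastic ℝ V) {δ : ℝ}
    (hδ0 : 0 < δ) (hδ1 : δ < 1) (hδ : ∀ x, δ ≤ (P ^ 2) x x) (g l : ℕ) :
    ‖P ^ (g + 2 * l) - P ^ g‖ ≤ l * (√((g / 2 + 1 : ℕ) * δ))⁻¹ := by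
  have hq : 0 < 1 - δ := by linarith
  set R : Matrix V V ℝ := (1 - δ)⁻¹ • (P ^ 2 - δ • 1) with hRdef
  have hR : R ∈ rowStochastic ℝ V := by
    rw [mem_rowStochastic_iff_sum]
    have hP2 := mem_rowStochastic_iff_sum.1 (pow_mem hP 2)
    refine ⟨fun x y => ?_, fun x => ?_⟩
    · refine mul_nonneg (inv_nonneg.2 hq.le) ?_
      rcases eq_or_ne x y with rfl | hxy
      · simpa using hδ x
      · simpa [one_apply_ne hxy] using hP2.1 x y
    · simp only [hRdef, Matrix.smul_apply, Matrix.sub_apply, smul_eq_mul, ← Finset.mul_sum,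
        Finset.sum_sub_distrib, hP2.2 x]
      simp [one_apply, hq.ne']
  have hQ : (1 - (1 - δ)) • 1 + (1 - δ) • R = P ^ 2 := by
    rw [hRdef, smul_smul, mul_inv_cancel₀ hq.ne', one_smul, sub_sub_cancel]
    abel
  have hstep : ∀ j : ℕ, ‖P ^ (g + 2 * (j + 1)) - P ^ (g + 2 * j)‖ ≤
      (√((g / 2 + 1 : ℕ) * δ))⁻¹ := by
    intro j
    have h := norm_lazy_pow_mul_one_sub_le R
      (fun i => linftyOpNorm_le_one (pow_mem hR i)) hq (by linarith) (g / 2)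
    have hfac : P ^ (g + 2 * (j + 1)) - P ^ (g + 2 * j) =
        (-(1 - δ)) • (P ^ (g % 2 + 2 * j) *
          (((1 - (1 - δ)) • 1 + (1 - δ) • R) ^ (g / 2) * (1 - R))) := by
      rw [hQ]
      have h1 : (1 - δ) • (1 - R) = 1 - P ^ 2 := by
        rw [← hQ, sub_sub_cancel, smul_sub, sub_smul, one_smul]
        abel
      rw [neg_smul, ← mul_smul_comm, ← mul_smul_comm, h1, ← mul_assoc, ← pow_mul, ← pow_add,
        mul_sub, mul_one, ← pow_add, neg_sub]
      congr 2 <;> omega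
    rw [hfac, norm_smul, norm_neg, Real.norm_of_nonneg hq.le]
    have hmul : ‖P ^ (g % 2 + 2 * j) *
          (((1 - (1 - δ)) • 1 + (1 - δ) • R) ^ (g / 2) * (1 - R))‖ ≤
        (√((g / 2 + 1 : ℕ) * (1 - δ) * (1 - (1 - δ))))⁻¹ :=
      ((norm_mul_le _ _).trans (mul_le_of_le_one_left (norm_nonneg _)
        (linftyOpNorm_le_one (pow_mem hP _)))).trans h
    refine (mul_le_mul_of_nonneg_left hmul hq.le).trans ?_
    have hsplit : ((g / 2 + 1 : ℕ) : ℝ) * (1 - δ) * (1 - (1 - δ)) =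
        (1 - δ) * ((g / 2 + 1 : ℕ) * δ) := by ring
    rw [hsplit, Real.sqrt_mul hq.le, mul_inv, ← mul_assoc, ← div_eq_mul_inv (1 - δ), Real.div_sqrt]
    exact mul_le_of_le_one_left (by positivity) (Real.sqrt_le_one.2 (by linarith))
  induction l with
  | zero => simp
  | succ l ih =>
    have : P ^ (g + 2 * (l + 1)) - P ^ g =
        (P ^ (g + 2 * (l + 1)) - P ^ (g + 2 * l)) + (P ^ (g + 2 * l) - P ^ g) := by abel
    rw [this]
    refine (norm_add_le _ _).trans ?_
    push_cast at *
    linarith [hstep l]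

/-- If the chain is nearly singular to `stat` at all times of a net `Γ` of the bulk of the
binomial distribution, then the lazy chain is far from `stat`. -/
lemma le_tv_lazyMatrix_of_net {P : Matrix V V ℝ} (hP : P ∈ rowStochastic ℝ V) {stat : V → ℝ}
    (hpos : ∀ y, 0 ≤ stat y) (hsum : ∑ y, stat y = 1) (x : V) (Γ : Finset ℕ) {ε η a : ℝ}
    (hε : 0 ≤ ε) (hη : 0 ≤ η)
    (ha : 0 < a) (T : ℕ) (hΓ : ∀ g ∈ Γ, 1 - ε ≤ 2⁻¹ * ∑ y, |(P ^ g) x y - stat y|)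
    (hnet : ∀ k : ℕ, |(T : ℝ) / 2 - k| < a → ∃ g ∈ Γ, ‖P ^ k - P ^ g‖ ≤ η) :
    1 - (Γ.card + 1) * ε - η - T / 4 / a ^ 2 ≤
      2⁻¹ * ∑ y, |(lazyMatrix P ^ T) x y - stat y| := by
  have hb : ∀ k, 0 ≤ binomialWeight T 2⁻¹ k :=
    binomialWeight_nonneg (by norm_num) (by norm_num) T
  have hzero : ∀ {M : Matrix V V ℝ}, M ∈ rowStochastic ℝ V → ∑ y, (stat y - M x y) = 0 :=
    fun hM => by rw [Finset.sum_sub_distrib, hsum, sum_row_of_mem_rowStochastic hM, sub_self]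
  have hB : ∀ g ∈ Γ, 1 - ε ≤ ∑ y with 0 < stat y - (P ^ g) x y, (stat y - (P ^ g) x y) := by
    intro g hg
    rw [← half_sum_abs_eq_sum_pos _ (hzero (pow_mem hP g))]
    simpa only [abs_sub_comm] using hΓ g hg
  set A : Finset V := {y | ∀ g ∈ Γ, 0 < stat y - (P ^ g) x y} with hA
  have hstatA : 1 - Γ.card * ε ≤ ∑ y ∈ A, stat y := by
    have h1 : ∑ y ∈ Aᶜ, stat y ≤ ∑ g ∈ Γ, ∑ y with ¬ 0 < stat y - (P ^ g) x y, stat y := by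
      simp only [Finset.sum_filter]
      rw [Finset.sum_comm]
      refine le_trans (Finset.sum_le_sum fun y hy => ?_) (Finset.sum_le_sum_of_subset_of_nonneg
        (Finset.subset_univ Aᶜ) fun y _ _ => Finset.sum_nonneg fun g _ => ?_)
      · obtain ⟨g, hg, hgy⟩ : ∃ g ∈ Γ, ¬ 0 < stat y - (P ^ g) x y := by
          simpa only [hA, Finset.mem_compl, Finset.mem_filter_univ, not_forall, exists_prop]
            using hy
        exact (if_pos hgy).symm.trans_le (Finset.single_le_sum
          (f := fun g => if ¬ 0 < stat y - (P ^ g) x y then stat y else 0)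
          (fun g _ => by split_ifs <;> simp [hpos y]) hg)
      · split_ifs <;> simp [hpos y]
    have h2 : ∀ g ∈ Γ, ∑ y with ¬ 0 < stat y - (P ^ g) x y, stat y ≤ ε := by
      intro g hg
      have h3 := Finset.sum_filter_add_sum_filter_not Finset.univ
        (fun y => 0 < stat y - (P ^ g) x y) stat
      have h4 := hB g hg
      rw [Finset.sum_sub_distrib] at h4
      have h5 : 0 ≤ ∑ y with 0 < stat y - (P ^ g) x y, (P ^ g) x y :=
        Finset.sum_nonneg fun y _ => nonneg_of_mem_rowStochastic (pow_mem hP g)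
      linarith
    have h6 := Finset.sum_le_card_nsmul Γ _ ε h2
    rw [nsmul_eq_mul] at h6
    have h7 := Finset.sum_add_sum_compl A stat
    linarith
  have hPA : ∀ g ∈ Γ, ∑ y ∈ A, (P ^ g) x y ≤ ε := by
    intro g hg
    have hsub : A ⊆ ({y | 0 < stat y - (P ^ g) x y} : Finset V) := by
      intro y hy
      simp only [hA, Finset.mem_filter_univ] at hy ⊢
      exact hy g hg
    have h1 := Finset.sum_le_sum_of_subset_of_nonneg hsub
      fun y _ _ => nonneg_of_mem_rowStochastic (i := x) (j := y) (pow_mem hP g)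
    have h2 := hB g hg
    rw [Finset.sum_sub_distrib] at h2
    have h3 : ∑ y with 0 < stat y - (P ^ g) x y, stat y ≤ 1 := by
      rw [← hsum]
      exact Finset.sum_le_sum_of_subset_of_nonneg (Finset.subset_univ _) fun y _ _ => hpos y
    linarith
  have hPk : ∀ k : ℕ, |(T : ℝ) / 2 - k| < a → ∑ y ∈ A, (P ^ k) x y ≤ ε + η := by
    intro k hk
    obtain ⟨g, hg, hkg⟩ := hnet k hk
    have h1 : ∑ y ∈ A, ((P ^ k) x y - (P ^ g) x y) ≤ ‖P ^ k - P ^ g‖ :=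
      (Finset.sum_le_sum fun y _ => le_abs_self _).trans
        ((Finset.sum_le_sum_of_subset_of_nonneg (Finset.subset_univ _)
          fun y _ _ => abs_nonneg _).trans (sum_abs_le_linftyOpNorm (P ^ k - P ^ g) x))
    rw [Finset.sum_sub_distrib] at h1
    linarith [hPA g hg]
  have hLA : ∑ y ∈ A, (lazyMatrix P ^ T) x y ≤ ε + η + T / 4 / a ^ 2 := by
    have hexp : ∑ y ∈ A, (lazyMatrix P ^ T) x y =
        ∑ k ∈ Finset.range (T + 1), binomialWeight T 2⁻¹ k * ∑ y ∈ A, (P ^ k) x y := by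
      simp only [lazyMatrix_pow_eq_sum, Matrix.sum_apply, Matrix.smul_apply, smul_eq_mul,
        Finset.mul_sum]
      exact Finset.sum_comm
    have hterm : ∀ k ∈ Finset.range (T + 1),
        binomialWeight T 2⁻¹ k * ∑ y ∈ A, (P ^ k) x y ≤ binomialWeight T 2⁻¹ k * (ε + η) +
          if a ≤ |(T : ℝ) * 2⁻¹ - k| then binomialWeight T 2⁻¹ k else 0 := by
      intro k _
      split_ifs with hk
      · have : ∑ y ∈ A, (P ^ k) x y ≤ 1 := by
          rw [← sum_row_of_mem_rowStochastic (pow_mem hP k) x]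
          exact Finset.sum_le_sum_of_subset_of_nonneg (Finset.subset_univ _)
            fun y _ _ => nonneg_of_mem_rowStochastic (pow_mem hP k)
        nlinarith [hb k, mul_le_mul_of_nonneg_left this (hb k),
          mul_nonneg (hb k) (add_nonneg hε hη)]
      · rw [add_zero]
        exact mul_le_mul_of_nonneg_left (hPk k (by simpa [div_eq_mul_inv] using hk)) (hb k)
    have hfar := sum_binomialWeight_le_of_far (n := T) (p := 2⁻¹) (by norm_num) (by norm_num) ha
      ((Finset.range (T + 1)).filter fun k : ℕ => a ≤ |(T : ℝ) * 2⁻¹ - k|)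
      (Finset.filter_subset _ _) fun k hk => (Finset.mem_filter.1 hk).2
    rw [hexp]
    refine (Finset.sum_le_sum hterm).trans ?_
    rw [Finset.sum_add_distrib, ← Finset.sum_mul, sum_binomialWeight, ← Finset.sum_filter]
    have : (T : ℝ) * 2⁻¹ * (1 - 2⁻¹) / a ^ 2 = T / 4 / a ^ 2 := by ring
    linarith
  have hfin := sum_le_half_sum_abs _
    (hzero (pow_mem (lazyMatrix_mem_rowStochastic hP) T)) A
  simp only [abs_sub_comm (stat _)] at hfin
  rw [Finset.sum_sub_distrib] at hfin
  linarith

/-- A chain that is not mixed at the end of a window around `T / 2` has a lazy version that is not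
mixed at time `T`. -/
lemma not_mixedAt_lazyMatrix {P : Matrix V V ℝ} (hP : P ∈ rowStochastic ℝ V) {stat : V → ℝ}
    (hpos : ∀ y, 0 ≤ stat y) (hsum : ∑ y, stat y = 1) (hstat : stat ᵥ* P = stat) {δ : ℝ}
    (hδ0 : 0 < δ) (hδ1 : δ < 1) (hδ : ∀ x, δ ≤ (P ^ 2) x x) {ε η a θ : ℝ} (hε : 0 ≤ ε)
    (hη : 0 ≤ η) (ha : 0 < a) {T b r N : ℕ} (hr : 0 < r)
    (hnot : ¬ mixedAt P stat (1 - ε) (b + 2 * r * N))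
    (hlow : (b : ℝ) ≤ T / 2 - a) (hhigh : (T : ℝ) / 2 + a ≤ b + 2 * r * N)
    (hsmooth : r * (√((b / 2 + 1 : ℕ) * δ))⁻¹ ≤ η)
    (hθ : θ < 1 - (2 * N + 1) * ε - η - T / 4 / a ^ 2) :
    ¬ mixedAt (lazyMatrix P) stat θ T := by
  simp only [mixedAt, not_forall, not_le] at hnot ⊢
  obtain ⟨x, hx⟩ := hnot
  refine ⟨x, hθ.trans_le ?_⟩
  set Γ : Finset ℕ := (Finset.range N ×ˢ Finset.range 2).image fun i => b + 2 * r * i.1 + i.2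
    with hΓdef
  have hcard : (Γ.card : ℝ) ≤ 2 * N := by
    have h : Γ.card ≤ N * 2 := by simpa using Finset.card_image_le (s :=
      Finset.range N ×ˢ Finset.range 2) (f := fun i => b + 2 * r * i.1 + i.2)
    have h' : (Γ.card : ℝ) ≤ N * 2 := by exact_mod_cast h
    linarith
  have h := le_tv_lazyMatrix_of_net hP hpos hsum x Γ hε hη ha T ?_ ?_
  · refine le_trans ?_ h
    have := mul_le_mul_of_nonneg_right hcard hε
    linarith
  · intro g hg
    obtain ⟨⟨i, e⟩, hi, rfl⟩ := Finset.mem_image.1 hg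
    simp only [Finset.mem_product, Finset.mem_range] at hi
    have hle : b + 2 * r * i + e ≤ b + 2 * r * N := by
      have : 2 * r * (i + 1) ≤ 2 * r * N := Nat.mul_le_mul_left _ hi.1
      have h2 : 2 * r * (i + 1) = 2 * r * i + 2 * r := by ring
      omega
    refine hx.le.trans ?_
    have := sum_abs_pow_sub_antitone hP hstat x hle
    linarith
  · intro k hk
    rw [abs_lt] at hk
    have hbk : b ≤ k := by
      have : (b : ℝ) < k := by linarith
      exact_mod_cast this.le
    have hkN : k < b + 2 * r * N := by
      have : (k : ℝ) < b + 2 * r * N := by linarith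
      exact_mod_cast this
    obtain ⟨u, rfl⟩ := Nat.exists_eq_add_of_le hbk
    have hdiv := Nat.div_add_mod u (2 * r)
    have hmod : u % (2 * r) < 2 * r := Nat.mod_lt _ (by omega)
    have hmod2 := Nat.div_add_mod (u % (2 * r)) 2
    set i := u / (2 * r)
    set e := u % (2 * r) % 2
    set l := u % (2 * r) / 2
    have hi : i < N := by
      apply Nat.div_lt_of_lt_mul
      omega
    have he : e < 2 := Nat.mod_lt _ two_pos
    refine ⟨b + 2 * r * i + e, Finset.mem_image.2 ⟨(i, e), by simp [hi, he], rfl⟩, ?_⟩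
    have hu : b + u = (b + 2 * r * i + e) + 2 * l := by omega
    rw [hu]
    refine (norm_pow_add_two_mul_sub_le hP hδ0 hδ1 hδ _ l).trans (le_trans ?_ hsmooth)
    have hlr : l ≤ r := by omega
    have hbg : b / 2 + 1 ≤ (b + 2 * r * i + e) / 2 + 1 := by
      have : b / 2 ≤ (b + 2 * r * i + e) / 2 := Nat.div_le_div_right (by omega)
      omega
    gcongr

end Chains

section Graphs

open Matrix

variable {V : Type*} [Fintype V] {G : SimpleGraph V} [DecidableRel G.Adj]

lemma card_le_two_mul_card_edges (hpos : ∀ x, 0 < G.degree x) :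
    (Fintype.card V : ℝ) ≤ 2 * G.edgeFinset.card := by
  have hE : ∑ x, (G.degree x : ℝ) = 2 * G.edgeFinset.card := by
    exact_mod_cast G.sum_degrees_eq_twice_card_edges
  rw [← hE]
  have : ∑ _x : V, (1 : ℝ) ≤ ∑ x, (G.degree x : ℝ) :=
    Finset.sum_le_sum fun x _ => by exact_mod_cast hpos x
  simpa using this

variable [DecidableEq V]

lemma srwMatrix_mem_rowStochastic (hpos : ∀ x, 0 < G.degree x) :
    srwMatrix G ∈ rowStochastic ℝ V := by
  rw [mem_rowStochastic_iff_sum]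
  refine ⟨fun x y => ?_, fun x => ?_⟩
  · unfold srwMatrix
    split_ifs <;> positivity
  · have h : (G.degree x : ℝ) ≠ 0 := by exact_mod_cast (hpos x).ne'
    simp only [srwMatrix, ← Finset.sum_filter, Finset.sum_const, ← G.neighborFinset_eq_filter,
      G.card_neighborFinset_eq_degree, nsmul_eq_mul]
    exact mul_inv_cancel₀ h

lemma srwPi_nonneg (x : V) : 0 ≤ srwPi G x := by
  unfold srwPi
  positivity

lemma sum_srwPi [Nonempty V] (hpos : ∀ x, 0 < G.degree x) : ∑ x, srwPi G x = 1 := by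
  have h := card_le_two_mul_card_edges hpos
  have hV : (0 : ℝ) < Fintype.card V := by exact_mod_cast Fintype.card_pos
  have hE : ∑ x, (G.degree x : ℝ) = 2 * G.edgeFinset.card := by
    exact_mod_cast G.sum_degrees_eq_twice_card_edges
  simp only [srwPi, ← Finset.sum_div, hE]
  exact div_self (by linarith)

lemma srwPi_vecMul_srwMatrix : srwPi G ᵥ* srwMatrix G = srwPi G := by
  funext y
  have h : ∀ x, srwPi G x * srwMatrix G x y =
      if G.Adj y x then (2 * (G.edgeFinset.card : ℝ))⁻¹ else 0 := by
    intro x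
    unfold srwPi srwMatrix
    by_cases hxy : G.Adj x y
    · rw [if_pos hxy, if_pos hxy.symm]
      have : (G.degree x : ℝ) ≠ 0 := by
        exact_mod_cast ((G.degree_pos_iff_exists_adj x).2 ⟨y, hxy⟩).ne'
      field_simp
    · rw [if_neg hxy, if_neg fun h => hxy h.symm, mul_zero]
  simp only [vecMul, dotProduct, h, ← Finset.sum_filter, Finset.sum_const,
    ← G.neighborFinset_eq_filter, G.card_neighborFinset_eq_degree, nsmul_eq_mul]
  rfl

lemma inv_le_srwMatrix_sq {Δ : ℕ} (hpos : ∀ x, 0 < G.degree x) (hdeg : ∀ x, G.degree x ≤ Δ)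
    (x : V) : ((Δ : ℝ) + 1)⁻¹ ≤ (srwMatrix G ^ 2) x x := by
  have hP := mem_rowStochastic_iff_sum.1 (srwMatrix_mem_rowStochastic hpos)
  rw [pow_two, mul_apply]
  calc ((Δ : ℝ) + 1)⁻¹ = ∑ y, srwMatrix G x y * ((Δ : ℝ) + 1)⁻¹ := by
        rw [← Finset.sum_mul, hP.2, one_mul]
    _ ≤ ∑ y, srwMatrix G x y * srwMatrix G y x := by
        refine Finset.sum_le_sum fun y _ => ?_
        by_cases hxy : G.Adj x y
        · refine mul_le_mul_of_nonneg_left ?_ (hP.1 x y)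
          have h1 : (G.degree y : ℝ) ≤ Δ := by exact_mod_cast hdeg y
          have h2 : (0 : ℝ) < G.degree y := by exact_mod_cast hpos y
          rw [srwMatrix, if_pos hxy.symm]
          exact inv_anti₀ h2 (by linarith)
        · simp [srwMatrix, hxy]

lemma card_support_srwMatrix_pow_le {Δ : ℕ} (hdeg : ∀ x, G.degree x ≤ Δ) (x : V) (t : ℕ) :
    (Finset.univ.filter fun y => (srwMatrix G ^ t) x y ≠ 0).card ≤ Δ ^ t := by
  induction t with
  | zero =>
    have : (Finset.univ.filter fun y => (srwMatrix G ^ 0) x y ≠ 0) ⊆ {x} := by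
      intro y hy
      simpa [one_apply, eq_comm] using hy
    simpa using Finset.card_le_card this
  | succ t ih =>
    have hsub : (Finset.univ.filter fun y => (srwMatrix G ^ (t + 1)) x y ≠ 0) ⊆
        (Finset.univ.filter fun y => (srwMatrix G ^ t) x y ≠ 0).biUnion
          fun z => G.neighborFinset z := by
      intro y hy
      rw [Finset.mem_filter_univ, pow_succ, mul_apply] at hy
      obtain ⟨z, -, hz⟩ := Finset.exists_ne_zero_of_sum_ne_zero hy
      have hadj : G.Adj z y := by
        by_contra hn
        simp [srwMatrix, hn] at hz
      simp only [Finset.mem_biUnion, Finset.mem_filter_univ, SimpleGraph.mem_neighborFinset]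
      exact ⟨z, left_ne_zero_of_mul hz, hadj⟩
    refine (Finset.card_le_card hsub).trans ((Finset.card_biUnion_le_card_mul _ _ Δ
      fun z _ => hdeg z).trans ?_)
    rw [pow_succ]
    exact Nat.mul_le_mul_right _ ih

/-- A random walk that has half mixed by time `t` has reached a sizable part of the graph. -/
lemma card_le_of_mixedAt [Nonempty V] {Δ : ℕ} (hpos : ∀ x, 0 < G.degree x)
    (hdeg : ∀ x, G.degree x ≤ Δ) {t : ℕ} (h : mixedAt (srwMatrix G) (srwPi G) 2⁻¹ t) :
    Fintype.card V ≤ 2 * Δ ^ (t + 1) := by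
  obtain ⟨x⟩ := ‹Nonempty V›
  have : Nonempty V := ⟨x⟩
  set B : Finset V := Finset.univ.filter fun y => (srwMatrix G ^ t) x y ≠ 0 with hB
  have hP := pow_mem (srwMatrix_mem_rowStochastic hpos) t
  have hsum := sum_srwPi hpos
  have h1 := sum_le_half_sum_abs (fun y => srwPi G y - (srwMatrix G ^ t) x y)
    (by rw [Finset.sum_sub_distrib, hsum, sum_row_of_mem_rowStochastic hP, sub_self]) Bᶜ
  simp only [abs_sub_comm (srwPi G _)] at h1
  have h2 : ∑ y ∈ Bᶜ, (srwPi G y - (srwMatrix G ^ t) x y) = ∑ y ∈ Bᶜ, srwPi G y := by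
    refine Finset.sum_congr rfl fun y hy => ?_
    have : (srwMatrix G ^ t) x y = 0 := by simpa [hB] using hy
    rw [this, sub_zero]
  have h3 := Finset.sum_add_sum_compl B (srwPi G)
  have hV : (0 : ℝ) < Fintype.card V := by exact_mod_cast Fintype.card_pos
  have hE := card_le_two_mul_card_edges hpos
  have h4 : ∑ y ∈ B, srwPi G y ≤ B.card • ((Δ : ℝ) / Fintype.card V) := by
    refine Finset.sum_le_card_nsmul _ _ _ fun y _ => ?_
    have : (G.degree y : ℝ) ≤ Δ := by exact_mod_cast hdeg y
    unfold srwPi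
    gcongr
  have h5 : (B.card : ℝ) ≤ (Δ : ℝ) ^ t := by
    exact_mod_cast card_support_srwMatrix_pow_le hdeg x t
  have h6 : (2 : ℝ)⁻¹ ≤ (Δ : ℝ) ^ t * (Δ / Fintype.card V) := by
    rw [nsmul_eq_mul] at h4
    have h7 := mul_le_mul_of_nonneg_right h5
      (show (0 : ℝ) ≤ Δ / Fintype.card V by positivity)
    linarith [h x]
  rw [← mul_div_assoc, le_div_iff₀ hV, ← pow_succ] at h6
  have h8 : (Fintype.card V : ℝ) ≤ 2 * (Δ : ℝ) ^ (t + 1) := by linarith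
  exact_mod_cast h8

end Graphs

section Asymptotics

lemma hasCutoff_of_eventually {tm : ℕ → ℝ → ℕ} (t s : ℕ → ℝ) (ht : ∀ n, 0 < t n)
    (hs : ∀ n, 0 < s n) (hst : Tendsto (fun n => s n / t n) atTop (nhds 0))
    (h : ∀ θ ∈ Set.Ioo (0 : ℝ) 1, ∃ c : ℝ, ∀ᶠ n in atTop,
      t n - c * s n ≤ (tm n θ : ℝ) ∧ (tm n θ : ℝ) ≤ t n + c * s n) :
    hasCutoff tm := by
  refine ⟨t, s, ht, fun n => (hs n).le, hst, fun θ hθ => ?_⟩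
  obtain ⟨c, hc⟩ := h θ hθ
  obtain ⟨N, hN⟩ := eventually_atTop.1 hc
  set f : ℕ → ℝ := fun n => |(tm n θ : ℝ) - t n| / s n with hf
  have hf0 : ∀ n, 0 ≤ f n := fun n => div_nonneg (abs_nonneg _) (hs n).le
  refine ⟨|c| + ∑ n ∈ Finset.range N, f n, fun n => ?_⟩
  have key : |(tm n θ : ℝ) - t n| ≤ (|c| + ∑ n ∈ Finset.range N, f n) * s n := by
    rcases lt_or_ge n N with hn | hn
    · have h1 : f n ≤ ∑ n ∈ Finset.range N, f n :=
        Finset.single_le_sum (fun i _ => hf0 i) (Finset.mem_range.2 hn)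
      rw [← div_le_iff₀ (hs n)]
      linarith [abs_nonneg c]
    · have h1 : |(tm n θ : ℝ) - t n| ≤ c * s n := by
        rw [abs_le]
        constructor <;> linarith [hN n hn]
      refine h1.trans (mul_le_mul_of_nonneg_right ?_ (hs n).le)
      linarith [le_abs_self c, Finset.sum_nonneg fun i (_ : i ∈ Finset.range N) => hf0 i]
  rw [abs_le] at key
  constructor <;> linarith

lemma eventually_mul_le_of_div_tendsto_zero {s t : ℕ → ℝ} (ht : ∀ n, 0 < t n)
    (hst : Tendsto (fun n => s n / t n) atTop (nhds 0)) (C : ℝ) {κ : ℝ} (hκ : 0 < κ) :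
    ∀ᶠ n in atTop, C * s n ≤ κ * t n := by
  have h := hst.const_mul C
  rw [mul_zero] at h
  filter_upwards [h.eventually_le_const hκ] with n hn
  rwa [← mul_div_assoc, div_le_iff₀ (ht n)] at hn

end Asymptotics

section CutoffTransfer

variable {V : ℕ → Type} [∀ n, Fintype (V n)] [∀ n, DecidableEq (V n)]
  {G : ∀ n, SimpleGraph (V n)} [∀ n, DecidableRel (G n).Adj] {t s : ℕ → ℝ}

/-- A positive mixing time is attained. -/
lemma mixedAt_tmix {W : Type*} [Fintype W] [DecidableEq W] {P : Matrix W W ℝ} {stat : W → ℝ}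
    {θ : ℝ} (h : 0 < tmix P stat θ) : mixedAt P stat θ (tmix P stat θ) :=
  Nat.sInf_mem (Nat.nonempty_of_pos_sInf h)

lemma eventually_tmix_pos (ht : ∀ n, 0 < t n)
    (hst : Tendsto (fun n => s n / t n) atTop (nhds 0)) {θ c : ℝ}
    (hc : ∀ n, t n - c * s n ≤ (tmix (srwMatrix (G n)) (srwPi (G n)) θ : ℝ)) :
    ∀ᶠ n in atTop, 0 < tmix (srwMatrix (G n)) (srwPi (G n)) θ := by
  filter_upwards [eventually_mul_le_of_div_tendsto_zero ht hst c (half_pos one_pos)] with n hn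
  have h1 := hc n
  have h2 := ht n
  have : (0 : ℝ) < (tmix (srwMatrix (G n)) (srwPi (G n)) θ : ℝ) := by linarith
  exact_mod_cast this

lemma tendsto_cutoff_time {Δ : ℕ} (hpos : ∀ᶠ n in atTop, ∀ x, 0 < (G n).degree x)
    (hdeg : ∀ n x, (G n).degree x ≤ Δ)
    (hcard : Tendsto (fun n => Fintype.card (V n)) atTop atTop)
    (ht : ∀ n, 0 < t n) (hst : Tendsto (fun n => s n / t n) atTop (nhds 0)) {c : ℝ}
    (hc : ∀ n, t n - c * s n ≤ (tmix (srwMatrix (G n)) (srwPi (G n)) 2⁻¹ : ℝ) ∧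
      (tmix (srwMatrix (G n)) (srwPi (G n)) 2⁻¹ : ℝ) ≤ t n + c * s n) :
    Tendsto t atTop atTop := by
  rw [tendsto_atTop]
  intro B
  obtain ⟨k, hk⟩ := exists_nat_ge (2 * B)
  filter_upwards [hpos, eventually_tmix_pos ht hst fun n => (hc n).1,
    eventually_mul_le_of_div_tendsto_zero ht hst c one_pos,
    hcard.eventually_gt_atTop (2 * (Δ + 1) ^ (k + 1))] with n hpos hmix hcs hbig
  have : Nonempty (V n) := Fintype.card_pos_iff.1 (by omega)
  have h1 := card_le_of_mixedAt hpos (fun x => (hdeg n x).trans (Nat.le_succ Δ))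
    (mixedAt_tmix hmix)
  have h2 : k ≤ tmix (srwMatrix (G n)) (srwPi (G n)) 2⁻¹ := by
    by_contra hlt
    push Not at hlt
    have h3 : (Δ + 1) ^ (tmix (srwMatrix (G n)) (srwPi (G n)) 2⁻¹ + 1) ≤ (Δ + 1) ^ (k + 1) :=
      Nat.pow_le_pow_right (Nat.succ_pos Δ) (by omega)
    simp only [Nat.succ_eq_add_one] at h1
    omega
  have h4 : (k : ℝ) ≤ (tmix (srwMatrix (G n)) (srwPi (G n)) 2⁻¹ : ℝ) := by exact_mod_cast h2
  have h5 := (hc n).2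
  linarith

lemma eventually_exists_mixedAt_lazyMatrix (hpos : ∀ᶠ n in atTop, ∀ x, 0 < (G n).degree x)
    (hne : ∀ n, Nonempty (V n)) (ht : ∀ n, 0 < t n) (hs : ∀ n, 0 ≤ s n)
    (hst : Tendsto (fun n => s n / t n) atTop (nhds 0))
    (hsqrt : Tendsto (fun n => √(t n) / t n) atTop (nhds 0)) (htop : Tendsto t atTop atTop)
    {θ c : ℝ} (hθ : θ ∈ Set.Ioo (0 : ℝ) 1)
    (hc : ∀ n, t n - c * s n ≤ (tmix (srwMatrix (G n)) (srwPi (G n)) (θ / 2) : ℝ) ∧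
      (tmix (srwMatrix (G n)) (srwPi (G n)) (θ / 2) : ℝ) ≤ t n + c * s n) :
    ∃ C : ℝ, ∀ᶠ n in atTop, ∃ T : ℕ, mixedAt (lazyMatrix (srwMatrix (G n))) (srwPi (G n)) θ T ∧
      (T : ℝ) ≤ 2 * t n + C * (s n + √(t n)) := by
  obtain ⟨hθ0, hθ1⟩ := hθ
  have hD : 0 < 2 / θ := by positivity
  refine ⟨2 * |c| + 2 * (2 / θ) + 1, ?_⟩
  filter_upwards [hpos, eventually_tmix_pos ht hst fun n => (hc n).1,
    eventually_mul_le_of_div_tendsto_zero ht hst (2 * |c|) (half_pos one_pos),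
    eventually_mul_le_of_div_tendsto_zero ht hsqrt (2 * (2 / θ)) (half_pos one_pos),
    htop.eventually_ge_atTop 1] with n hpos hmix hcs hDt ht1
  have := hne n
  set m := tmix (srwMatrix (G n)) (srwPi (G n)) (θ / 2)
  set a : ℝ := 2 / θ * √(t n) with ha
  have hsqrt1 : 1 ≤ √(t n) := Real.one_le_sqrt.2 ht1
  have ha0 : 0 < a := by positivity
  have hm : (m : ℝ) ≤ t n + |c| * s n :=
    (hc n).2.trans (by linarith [mul_le_mul_of_nonneg_right (le_abs_self c) (hs n)])
  have hT1 : 2 * ((m : ℝ) + a) ≤ ⌈2 * ((m : ℝ) + a)⌉₊ := Nat.le_ceil _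
  have hT2 : (⌈2 * ((m : ℝ) + a)⌉₊ : ℝ) < 2 * (m + a) + 1 := Nat.ceil_lt_add_one (by positivity)
  set T := ⌈2 * ((m : ℝ) + a)⌉₊
  refine ⟨T, ?_, ?_⟩
  · have h := mixedAt_lazyMatrix (srwMatrix_mem_rowStochastic hpos) srwPi_nonneg (sum_srwPi hpos)
      (half_pos hθ0).le ha0 (mixedAt_tmix hmix) (T := T) (by linarith)
    refine fun x => (h x).trans ?_
    have hT4 : (T : ℝ) ≤ 4 * t n := by linarith
    have hasq : a ^ 2 = 4 / θ ^ 2 * t n := by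
      rw [ha, mul_pow, Real.sq_sqrt (ht n).le]; ring
    have : (T : ℝ) / 4 / a ^ 2 ≤ θ / 2 := by
      rw [div_le_iff₀ (by positivity), hasq]
      have : θ / 2 * (4 / θ ^ 2 * t n) = 2 / θ * t n := by field_simp; ring
      rw [this]
      have h2 : 1 ≤ 2 / θ := by rw [le_div_iff₀ hθ0]; linarith
      nlinarith [ht n]
    linarith
  · have h1 : 0 ≤ 2 / θ * s n := mul_nonneg hD.le (hs n)
    have h2 : 0 ≤ |c| * √(t n) := by positivity
    have h3 := hs n
    linarith

lemma eventually_not_mixedAt_lazyMatrix {Δ : ℕ}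
    (hpos : ∀ᶠ n in atTop, ∀ x, 0 < (G n).degree x) (hdeg : ∀ n x, (G n).degree x ≤ Δ)
    (hne : ∀ n, Nonempty (V n)) (ht : ∀ n, 0 < t n) (hs : ∀ n, 0 ≤ s n)
    (hst : Tendsto (fun n => s n / t n) atTop (nhds 0))
    (hsqrt : Tendsto (fun n => √(t n) / t n) atTop (nhds 0)) (htop : Tendsto t atTop atTop)
    (hc : ∀ θ ∈ Set.Ioo (0 : ℝ) 1, ∃ c : ℝ, ∀ n,
      t n - c * s n ≤ (tmix (srwMatrix (G n)) (srwPi (G n)) θ : ℝ))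
    {θ : ℝ} (hθ : θ ∈ Set.Ioo (0 : ℝ) 1) :
    ∃ C : ℝ, ∀ᶠ n in atTop, ∀ T : ℕ, mixedAt (lazyMatrix (srwMatrix (G n))) (srwPi (G n)) θ T →
      2 * t n - C * (s n + √(t n)) ≤ T := by
  obtain ⟨hθ0, hθ1⟩ := hθ
  set ω : ℝ := 1 - θ with hω
  have hω0 : 0 < ω := by linarith
  have hω1 : ω < 1 := by linarith
  set δ : ℝ := (((Δ + 1 : ℕ) : ℝ) + 1)⁻¹ with hδ
  have hδ0 : 0 < δ := by positivity
  have hδ1 : δ < 1 := inv_lt_one_of_one_lt₀ (by push_cast; linarith [Nat.cast_nonneg (α := ℝ) Δ])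
  set M : ℝ := 2 / ω with hM
  have hM0 : 0 < M := by positivity
  set ρ : ℝ := ω / 4 * √δ / 4 with hρ
  have hρ0 : 0 < ρ := by positivity
  set N : ℕ := ⌈(2 * M + 1) / ρ⌉₊
  have hN : 2 * M + 1 ≤ ρ * N := by
    have := Nat.le_ceil ((2 * M + 1) / ρ)
    rw [div_le_iff₀ hρ0] at this
    linarith
  set ε : ℝ := ω / 4 / (2 * N + 1) with hε
  have hε0 : 0 < ε := by positivity
  have hεN : (2 * N + 1) * ε = ω / 4 := by rw [hε]; field_simp
  have hε1 : ε < 1 := by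
    have : ε ≤ ω / 4 := div_le_self (by positivity) (by linarith [Nat.cast_nonneg (α := ℝ) N])
    linarith
  obtain ⟨c, hc⟩ := hc (1 - ε) ⟨by linarith, by linarith⟩
  set C : ℝ := 2 * |c| + 4 * (ρ * N) + 1 with hC
  have hC0 : 0 < C := by positivity
  refine ⟨C, ?_⟩
  filter_upwards [hpos,
    eventually_mul_le_of_div_tendsto_zero ht hst C (show (0 : ℝ) < 1 / 8 by norm_num),
    eventually_mul_le_of_div_tendsto_zero ht hsqrt C (show (0 : ℝ) < 1 / 8 by norm_num),
    eventually_mul_le_of_div_tendsto_zero ht hsqrt M (show (0 : ℝ) < 1 / 8 by norm_num),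
    htop.eventually_ge_atTop 8,
    (Real.tendsto_sqrt_atTop.comp htop).eventually_ge_atTop (2 / ρ)] with
    n hpos hCs hCt hMt ht8 hρt
  have := hne n
  have hP := srwMatrix_mem_rowStochastic hpos
  set w : ℝ := √(t n) with hw
  have hw1 : 1 ≤ w := Real.one_le_sqrt.2 (by linarith)
  have hρw : 2 ≤ ρ * w := by
    have : 2 / ρ ≤ w := hρt
    rw [div_le_iff₀ hρ0] at this
    linarith
  have hsn := hs n
  have hu0 : 0 ≤ 2 * t n - C * (s n + w) := by linarith
  have hT1 : (⌊2 * t n - C * (s n + w)⌋₊ : ℝ) ≤ 2 * t n - C * (s n + w) := Nat.floor_le hu0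
  have hT2 : 2 * t n - C * (s n + w) < ⌊2 * t n - C * (s n + w)⌋₊ + 1 := Nat.lt_floor_add_one _
  set T : ℕ := ⌊2 * t n - C * (s n + w)⌋₊
  have hb1 : (⌊(T : ℝ) / 2 - M * w⌋₊ : ℝ) ≤ T / 2 - M * w := Nat.floor_le (by linarith)
  have hb2 : (T : ℝ) / 2 - M * w < ⌊(T : ℝ) / 2 - M * w⌋₊ + 1 := Nat.lt_floor_add_one _
  set b : ℕ := ⌊(T : ℝ) / 2 - M * w⌋₊
  have hr1 : (⌊ρ * w⌋₊ : ℝ) ≤ ρ * w := Nat.floor_le (by positivity)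
  have hr2 : ρ * w < ⌊ρ * w⌋₊ + 1 := Nat.lt_floor_add_one _
  set r : ℕ := ⌊ρ * w⌋₊
  have hr0 : 0 < r := by
    have : (0 : ℝ) < r := by linarith
    exact_mod_cast this
  have hCsw : 0 ≤ C * (s n + w) := by positivity
  have hrN1 : (2 * M + 1) * w ≤ 2 * r * N := by
    have h1 : (2 * M + 1) * w ≤ ρ * N * w := mul_le_mul_of_nonneg_right hN (by linarith)
    have h2 : ρ * w * N ≤ 2 * r * N :=
      mul_le_mul_of_nonneg_right (by linarith) (Nat.cast_nonneg N)
    linarith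
  have hrN2 : (r : ℝ) * N ≤ ρ * w * N := mul_le_mul_of_nonneg_right hr1 (Nat.cast_nonneg N)
  have hnot : ¬ mixedAt (srwMatrix (G n)) (srwPi (G n)) (1 - ε) (b + 2 * r * N) := by
    refine Nat.notMem_of_lt_sInf (s := {t | mixedAt (srwMatrix (G n)) (srwPi (G n)) (1 - ε) t}) ?_
    have h1 := hc n
    have h2 : c * s n ≤ |c| * s n := mul_le_mul_of_nonneg_right (le_abs_self c) hsn
    have h3 : C * (s n + w) =
        2 * (|c| * s n) + 2 * (|c| * w) + 4 * (ρ * N * s n) + 4 * (ρ * w * N) + s n + w := by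
      rw [hC]; ring
    have h4 : 0 ≤ |c| * w := by positivity
    have h5 : 0 ≤ ρ * N * s n := by positivity
    have h6 : 0 ≤ M * w := by positivity
    have h7 : ((b + 2 * r * N : ℕ) : ℝ) < (tmix (srwMatrix (G n)) (srwPi (G n)) (1 - ε) : ℝ) := by
      push_cast
      linarith
    exact_mod_cast h7
  have hsmooth : (r : ℝ) * (√((b / 2 + 1 : ℕ) * δ))⁻¹ ≤ ω / 4 := by
    have h1 : t n / 16 ≤ ((b / 2 + 1 : ℕ) : ℝ) := by
      have h2 : b ≤ 2 * (b / 2 + 1) := by omega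
      have h3 : (b : ℝ) ≤ 2 * ((b / 2 + 1 : ℕ) : ℝ) := by exact_mod_cast h2
      linarith
    have h4 : w * √δ / 4 ≤ √((b / 2 + 1 : ℕ) * δ) := by
      apply Real.le_sqrt_of_sq_le
      have : (w * √δ / 4) ^ 2 = t n / 16 * δ := by
        rw [div_pow, mul_pow, Real.sq_sqrt hδ0.le, hw, Real.sq_sqrt (ht n).le]; ring
      rw [this]
      exact mul_le_mul_of_nonneg_right h1 hδ0.le
    have hpos' : 0 < w * √δ / 4 := by positivity
    rw [← div_eq_mul_inv, div_le_iff₀ (hpos'.trans_le h4)]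
    calc (r : ℝ) ≤ ρ * w := hr1
      _ = ω / 4 * (w * √δ / 4) := by rw [hρ]; ring
      _ ≤ _ := mul_le_mul_of_nonneg_left h4 (by positivity)
  have htail : (T : ℝ) / 4 / (M * w) ^ 2 ≤ ω / 8 := by
    have h1 : (M * w) ^ 2 = 4 / ω ^ 2 * t n := by
      rw [mul_pow, hw, Real.sq_sqrt (ht n).le, hM, div_pow]
      norm_num
    rw [div_le_iff₀ (by positivity), h1]
    have h2 : ω / 8 * (4 / ω ^ 2 * t n) = t n / 2 / ω := by field_simp; ring
    rw [h2, le_div_iff₀ hω0]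
    nlinarith [Nat.cast_nonneg (α := ℝ) T]
  have hlazy := not_mixedAt_lazyMatrix hP srwPi_nonneg (sum_srwPi hpos) srwPi_vecMul_srwMatrix
    hδ0 hδ1 (inv_le_srwMatrix_sq hpos fun x => (hdeg n x).trans (Nat.le_succ Δ)) hε0.le
    (show 0 ≤ ω / 4 by positivity) (show 0 < M * w by positivity) hr0 hnot hb1 (by linarith)
    hsmooth (θ := θ) (by rw [hεN]; linarith)
  intro T' hT'
  by_contra hlt
  push Not at hlt
  refine hlazy (hT'.mono (lazyMatrix_mem_rowStochastic hP) hθ0.le ?_)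
  exact Nat.le_floor hlt.le

end CutoffTransfer

/-- If the simple random walks on a bounded-degree sequence `(G_n)` exhibit
cutoff, then so do the lazy random walks. -/
theorem stmt10 (Δ : ℕ)
    (V : ℕ → Type) [∀ n, Fintype (V n)] [∀ n, DecidableEq (V n)]
    (G : ∀ n, SimpleGraph (V n)) [∀ n, DecidableRel (G n).Adj]
    (hconn : ∀ n, (G n).Connected)
    (hdeg : ∀ n (x : V n), (G n).degree x ≤ Δ)
    (hcard : Tendsto (fun n => Fintype.card (V n)) atTop atTop)
    (hcut : hasCutoff (fun n θ => tmix (srwMatrix (G n)) (srwPi (G n)) θ)) :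
    hasCutoff (fun n θ => tmix (lazyMatrix (srwMatrix (G n))) (srwPi (G n)) θ) := by
  obtain ⟨t, s, ht, hs, hst, hc⟩ := hcut
  have hne : ∀ n, Nonempty (V n) := fun n => (hconn n).nonempty
  have hpos : ∀ᶠ n in atTop, ∀ x, 0 < (G n).degree x := by
    filter_upwards [hcard.eventually_gt_atTop 1] with n hn x
    have := Fintype.one_lt_card_iff_nontrivial.1 hn
    exact (hconn n).preconnected.degree_pos_of_nontrivial x
  obtain ⟨c, hchalf⟩ := hc 2⁻¹ ⟨by norm_num, by norm_num⟩
  have htop := tendsto_cutoff_time hpos hdeg hcard ht hst hchalf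
  have hsqrt : Tendsto (fun n => √(t n) / t n) atTop (nhds 0) := by
    simp only [Real.sqrt_div_self]
    exact tendsto_inv_atTop_zero.comp (Real.tendsto_sqrt_atTop.comp htop)
  refine hasCutoff_of_eventually (fun n => 2 * t n) (fun n => s n + √(t n))
    (fun n => mul_pos two_pos (ht n))
    (fun n => add_pos_of_nonneg_of_pos (hs n) (Real.sqrt_pos.2 (ht n))) ?_ fun θ hθ => ?_
  · have h := (hst.add hsqrt).const_mul 2⁻¹
    rw [add_zero, mul_zero] at h
    refine h.congr fun n => ?_
    have := (ht n).ne'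
    field_simp
  · obtain ⟨hθ0, hθ1⟩ := id hθ
    obtain ⟨c', hc'⟩ := hc (θ / 2) ⟨by linarith, by linarith⟩
    obtain ⟨C₁, h₁⟩ := eventually_exists_mixedAt_lazyMatrix hpos hne ht hs hst hsqrt htop hθ hc'
    obtain ⟨C₂, h₂⟩ := eventually_not_mixedAt_lazyMatrix hpos hdeg hne ht hs hst hsqrt htop
      (fun θ hθ => (hc θ hθ).imp fun _ h n => (h n).1) hθ
    refine ⟨max C₁ C₂, ?_⟩
    filter_upwards [h₁, h₂] with n ⟨T, hT, hTle⟩ h₂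
    have hw : 0 ≤ s n + √(t n) := add_nonneg (hs n) (Real.sqrt_nonneg _)
    have hmin : tmix (lazyMatrix (srwMatrix (G n))) (srwPi (G n)) θ ≤ T := Nat.sInf_le hT
    have hmin' : (tmix (lazyMatrix (srwMatrix (G n))) (srwPi (G n)) θ : ℝ) ≤ T := by
      exact_mod_cast hmin
    have hlow := h₂ _ (Nat.sInf_mem (s := {t | mixedAt _ _ θ t}) ⟨T, hT⟩)
    have hC₁ := mul_le_mul_of_nonneg_right (le_max_left C₁ C₂) hw
    have hC₂ := mul_le_mul_of_nonneg_right (le_max_right C₁ C₂) hw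
    refine ⟨le_trans ?_ hlow, ?_⟩ <;> linarith
end
end

section
/- Let Δ ∈ ℕ. There exists a constant C > 0 depending only on Δ such that for every finite connected vertex-transitive graph G of degree Δ, all vertices o, x, y and all integers t ≥ 1 and s ≥ 1, the lazy simple random walk on G satisfies |P_lazy^{t+s}(o,x) − P_lazy^{t+s}(o,y)| ≤ C·dist(x,y)·s^{−1/2}·P_lazy^t(o,o), where dist denotes the graph distance. -/
open Filter

noncomputable section

open Matrix

/-- The Cauchy–Schwarz inequality for the bilinear form of a positive semidefinite matrix. -/
lemma Matrix.PosSemidef.sq_dotProduct_mulVec_le {V : Type*} [Fintype V] {M : Matrix V V ℝ}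
    (hM : M.PosSemidef) (u v : V → ℝ) :
    (u ⬝ᵥ M *ᵥ v) ^ 2 ≤ (u ⬝ᵥ M *ᵥ u) * (v ⬝ᵥ M *ᵥ v) := by
  have hsymm : v ⬝ᵥ M *ᵥ u = u ⬝ᵥ M *ᵥ v := by
    have hT : Mᵀ = M := by simpa [Matrix.IsHermitian] using hM.isHermitian
    rw [dotProduct_mulVec, ← mulVec_transpose, hT, dotProduct_comm]
  have hquad : ∀ c : ℝ, 0 ≤ (v ⬝ᵥ M *ᵥ v) * (c * c) + (2 * (u ⬝ᵥ M *ᵥ v)) * c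
      + u ⬝ᵥ M *ᵥ u := by
    intro c
    have h := hM.dotProduct_mulVec_nonneg (u + c • v)
    simp only [star_trivial, mulVec_add, mulVec_smul, dotProduct_add, add_dotProduct,
      dotProduct_smul, smul_dotProduct, smul_eq_mul, hsymm] at h
    linarith
  have h := discrim_le_zero hquad
  unfold discrim at h
  linarith

/-- The quadratic form of a matrix at a difference of two indicator vectors. -/
lemma single_sub_single_dotProduct_mulVec {V : Type*} [Fintype V] [DecidableEq V]
    (M : Matrix V V ℝ) (x y : V) :
    (Pi.single x 1 - Pi.single y 1) ⬝ᵥ M *ᵥ (Pi.single x 1 - Pi.single y 1) =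
      M x x - M x y - M y x + M y y := by
  simp [mulVec_sub, sub_dotProduct]
  ring

/-- For a positive semidefinite `Q`, the decrements of the diagonal entries of `Q ^ (t + m)` in `m`
are nonincreasing, hence at most `(m + 1)⁻¹` times the initial value. -/
lemma Matrix.PosSemidef.mul_pow_diag_sub_le {V : Type*} [Fintype V] [DecidableEq V]
    {Q : Matrix V V ℝ} (hQ : Q.PosSemidef) (t m : ℕ) (x : V) :
    (m + 1 : ℝ) * ((Q ^ (t + m)) x x - (Q ^ (t + m + 1)) x x) ≤ (Q ^ t) x x := by
  have hanti : Antitone fun i : ℕ => (Q ^ (t + i)) x x - (Q ^ (t + i + 1)) x x := by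
    refine antitone_nat_of_succ_le fun i => ?_
    have hH : (1 - Q)ᴴ = 1 - Q := by
      rw [conjTranspose_sub, conjTranspose_one, hQ.isHermitian.eq]
    have h := ((hQ.pow (t + i)).conjTranspose_mul_mul_same (1 - Q)).diag_nonneg (i := x)
    have hexp : (1 - Q)ᴴ * Q ^ (t + i) * (1 - Q) =
        Q ^ (t + i) - Q ^ (t + i + 1) - (Q ^ (t + i + 1) - Q ^ (t + i + 1 + 1)) := by
      rw [hH, pow_succ' Q (t + i + 1), pow_succ Q (t + i), sub_mul, mul_sub, one_mul, mul_one,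
        sub_mul, mul_assoc, ← pow_succ' Q (t + i), ← pow_succ Q (t + i)]
    rw [hexp] at h
    simp only [sub_apply] at h
    rw [← add_assoc t i 1]
    linarith
  have htel := Finset.sum_range_sub' (fun i : ℕ => (Q ^ (t + i)) x x) (m + 1)
  have hle := Finset.card_nsmul_le_sum (Finset.range (m + 1))
    (fun i : ℕ => (Q ^ (t + i)) x x - (Q ^ (t + i + 1)) x x)
    ((Q ^ (t + m)) x x - (Q ^ (t + m + 1)) x x)
    fun i hi => hanti (Nat.le_of_lt_succ (Finset.mem_range.1 hi))
  have hnn := (hQ.pow (t + (m + 1))).diag_nonneg (i := x)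
  simp only [← add_assoc, add_zero, Finset.card_range, nsmul_eq_mul, Nat.cast_add,
    Nat.cast_one] at htel hle hnn
  linarith

section Lazy

variable {V : Type*} [Fintype V] [DecidableEq V] {G : SimpleGraph V} [DecidableRel G.Adj]

/-- The lazy walk on a regular graph is a multiple of the signless Laplacian, hence positive
semidefinite. -/
lemma posSemidef_lazyMatrix_srwMatrix {Δ : ℕ} (hΔ : 0 < Δ) (hdeg : ∀ x, G.degree x = Δ) :
    (lazyMatrix (srwMatrix G)).PosSemidef := by
  have heq : lazyMatrix (srwMatrix G) =
      (2 * (Δ : ℝ))⁻¹ • (G.incMatrix ℝ * (G.incMatrix ℝ)ᴴ) := by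
    have hΔ' : (Δ : ℝ) ≠ 0 := by positivity
    rw [conjTranspose_eq_transpose_of_trivial, SimpleGraph.incMatrix_mul_transpose]
    ext x y
    by_cases hxy : x = y
    · subst hxy
      simp [lazyMatrix, srwMatrix, hdeg]
      field_simp
    · by_cases ha : G.Adj x y <;> simp [lazyMatrix, srwMatrix, hdeg, hxy, ha]
      field_simp
  rw [heq]
  exact (posSemidef_self_mul_conjTranspose _).smul (by positivity)

/-- Powers of the lazy walk are invariant under graph automorphisms. -/
lemma lazyMatrix_srwMatrix_pow_apply_iso (φ : G ≃g G) (n : ℕ) (x y : V) :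
    ((lazyMatrix (srwMatrix G)) ^ n) (φ x) (φ y) = ((lazyMatrix (srwMatrix G)) ^ n) x y := by
  induction n generalizing x y with
  | zero => simp [one_apply]
  | succ n ih =>
    rw [pow_succ, mul_apply, mul_apply, ← φ.toEquiv.sum_comp]
    refine Finset.sum_congr rfl fun z _ => ?_
    have hstep : lazyMatrix (srwMatrix G) (φ z) (φ y) = lazyMatrix (srwMatrix G) z y := by
      simp [lazyMatrix, srwMatrix, one_apply, φ.map_adj_iff]
    exact congrArg₂ _ (ih x z) hstep

/-- Averaging over the neighbours of `x` of `Q ^ n` for the lazy walk `Q`. -/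
lemma sum_neighborFinset_lazyMatrix_pow {Δ : ℕ} (hΔ : 0 < Δ) (hdeg : ∀ x, G.degree x = Δ)
    (n : ℕ) (x : V) :
    ∑ y ∈ G.neighborFinset x, ((lazyMatrix (srwMatrix G)) ^ n) y x =
      Δ * (2 * ((lazyMatrix (srwMatrix G)) ^ (n + 1)) x x -
        ((lazyMatrix (srwMatrix G)) ^ n) x x) := by
  set Q := lazyMatrix (srwMatrix G) with hQ
  have hΔ' : (Δ : ℝ) ≠ 0 := by positivity
  have hP : srwMatrix G = (2 : ℝ) • Q - 1 := by
    rw [hQ, lazyMatrix, smul_smul]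
    norm_num
  have hmul : srwMatrix G * Q ^ n = (2 : ℝ) • Q ^ (n + 1) - Q ^ n := by
    rw [hP, sub_mul, smul_mul_assoc, one_mul, ← pow_succ']
  have hentry := congrFun (congrFun hmul x) x
  simp only [mul_apply, srwMatrix, hdeg, Matrix.sub_apply, Matrix.smul_apply, smul_eq_mul] at hentry
  rw [← hentry, Finset.mul_sum, G.neighborFinset_eq_filter, Finset.sum_filter]
  refine Finset.sum_congr rfl fun y _ => ?_
  split_ifs
  · field_simp
  · simp

/-- The gradient inequality across a single edge. -/
lemma abs_lazyMatrix_pow_sub_le_of_adj {Δ : ℕ} (hG : IsVertexTransitive G)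
    (hdeg : ∀ x, G.degree x = Δ) (o : V) {x y : V} (hxy : G.Adj x y) (t s : ℕ) (hs : 1 ≤ s) :
    |((lazyMatrix (srwMatrix G)) ^ (t + s)) o x - ((lazyMatrix (srwMatrix G)) ^ (t + s)) o y| ≤
      (2 * Δ + 1) / Real.sqrt s * ((lazyMatrix (srwMatrix G)) ^ t) o o := by
  have hΔ : 0 < Δ := by
    rw [← hdeg x]
    exact G.degree_pos_iff_exists_adj x |>.2 ⟨y, hxy⟩
  have hpsd := posSemidef_lazyMatrix_srwMatrix hΔ hdeg
  have hsum := sum_neighborFinset_lazyMatrix_pow hΔ hdeg (t + 2 * s) x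
  have hdiag : ∀ (n : ℕ) (z w : V), ((lazyMatrix (srwMatrix G)) ^ n) z z =
      ((lazyMatrix (srwMatrix G)) ^ n) w w := by
    intro n z w
    obtain ⟨φ, rfl⟩ := hG w z
    exact lazyMatrix_srwMatrix_pow_apply_iso φ n w w
  set Q := lazyMatrix (srwMatrix G)
  have hsymm : ∀ (n : ℕ) (z w : V), (Q ^ n) z w = (Q ^ n) w z := fun n z w => by
    simpa using ((hpsd.pow n).isHermitian.apply w z)
  have hgap : ∀ z, 0 ≤ (Q ^ (t + 2 * s)) x x - (Q ^ (t + 2 * s)) z x := by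
    intro z
    have h := (hpsd.pow (t + 2 * s)).dotProduct_mulVec_nonneg (Pi.single x 1 - Pi.single z 1)
    rw [star_trivial, single_sub_single_dotProduct_mulVec, hsymm _ x z, hdiag _ z x] at h
    linarith
  have hedge : (Q ^ (t + 2 * s)) x x - (Q ^ (t + 2 * s)) y x ≤
      2 * Δ * ((Q ^ (t + 2 * s)) x x - (Q ^ (t + 2 * s + 1)) x x) := by
    have h := Finset.single_le_sum (fun z _ => hgap z) ((G.mem_neighborFinset x y).2 hxy)
    rw [Finset.sum_sub_distrib, hsum, Finset.sum_const, G.card_neighborFinset_eq_degree, hdeg,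
      nsmul_eq_mul] at h
    linarith
  have hdecay := hpsd.mul_pow_diag_sub_le t (2 * s) x
  have hcs := (hpsd.pow t).sq_dotProduct_mulVec_le (Pi.single o 1)
    (Q ^ s *ᵥ (Pi.single x 1 - Pi.single y 1))
  have hQsT : (Q ^ s)ᵀ = Q ^ s := by ext z w; exact hsymm s w z
  have hform : (Q ^ s *ᵥ (Pi.single x 1 - Pi.single y 1)) ⬝ᵥ
      Q ^ t *ᵥ (Q ^ s *ᵥ (Pi.single x 1 - Pi.single y 1)) =
      2 * ((Q ^ (t + 2 * s)) x x - (Q ^ (t + 2 * s)) y x) := by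
    rw [dotProduct_comm, dotProduct_mulVec, ← mulVec_transpose, hQsT, mulVec_mulVec,
      mulVec_mulVec, ← pow_add, ← pow_add, dotProduct_comm, show s + t + s = t + 2 * s by ring,
      single_sub_single_dotProduct_mulVec, hsymm _ x y, hdiag _ y x]
    ring
  rw [hform, mulVec_mulVec, ← pow_add] at hcs
  simp only [mulVec_sub, mulVec_single_one, dotProduct_sub, single_dotProduct, one_mul,
    col_apply] at hcs
  rw [hdiag t x o] at hdecay
  have hq : 0 ≤ (Q ^ t) o o := (hpsd.pow t).diag_nonneg
  have hs0 : (0 : ℝ) < s := by exact_mod_cast hs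
  refine abs_le_of_sq_le_sq ?_ (by positivity)
  rw [mul_pow, div_pow, Real.sq_sqrt hs0.le, div_mul_eq_mul_div, le_div_iff₀ hs0]
  push_cast at hdecay
  set q := (Q ^ t) o o
  set g := (Q ^ (t + 2 * s)) x x - (Q ^ (t + 2 * s + 1)) x x
  have hΔ0 : (0 : ℝ) < Δ := by exact_mod_cast hΔ
  have hg : 0 ≤ g := by
    have := (hgap y).trans hedge
    exact nonneg_of_mul_nonneg_right this (by positivity)
  have hsg : s * g ≤ q := by nlinarith
  calc _ ≤ q * (2 * (2 * Δ * g)) * s := by gcongr; exact hcs.trans (by gcongr)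
    _ = 4 * Δ * q * (s * g) := by ring
    _ ≤ 4 * Δ * q * q := by gcongr
    _ ≤ (2 * Δ + 1) ^ 2 * q ^ 2 := by
      nlinarith [mul_nonneg (sq_nonneg (2 * (Δ : ℝ))) (sq_nonneg q), sq_nonneg q]

end Lazy

/-- A function varying by at most `K` across each edge is `K`-Lipschitz for the graph distance. -/
lemma SimpleGraph.Connected.abs_sub_le_mul_dist {V : Type*} {G : SimpleGraph V}
    (hG : G.Connected) {f : V → ℝ} {K : ℝ} (hf : ∀ x y, G.Adj x y → |f x - f y| ≤ K) (x y : V) :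
    |f x - f y| ≤ K * G.dist x y := by
  obtain ⟨p, hp⟩ := hG.exists_walk_length_eq_dist x y
  rw [← hp]
  clear hp
  induction p with
  | nil => simp
  | @cons u v w h p ih =>
    rw [Walk.length_cons, Nat.cast_add, Nat.cast_one, mul_add, mul_one]
    linarith [abs_sub_le (f u) (f v) (f w), hf u v h]

/-- Gradient inequality. On vertex-transitive graphs,
`|P_lazy^{t+s}(o,x) − P_lazy^{t+s}(o,y)| ≤ C·dist(x,y)·s^{-1/2}·P_lazy^t(o,o)`. -/
theorem stmt16 (Δ : ℕ) :
    ∃ C : ℝ, 0 < C ∧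
      ∀ (V : Type) [Fintype V] [DecidableEq V] (G : SimpleGraph V) [DecidableRel G.Adj],
        G.Connected → IsVertexTransitive G → (∀ x, G.degree x = Δ) →
        ∀ (o x y : V) (t s : ℕ), 1 ≤ t → 1 ≤ s →
          |((lazyMatrix (srwMatrix G)) ^ (t + s)) o x -
              ((lazyMatrix (srwMatrix G)) ^ (t + s)) o y| ≤
            C * (G.dist x y : ℝ) / Real.sqrt s * ((lazyMatrix (srwMatrix G)) ^ t) o o := by
  refine ⟨2 * Δ + 1, by positivity, ?_⟩
  intro V _ _ G _ hconn hG hdeg o x y t s _ hs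
  refine (hconn.abs_sub_le_mul_dist (fun x y hxy =>
    abs_lazyMatrix_pow_sub_le_of_adj hG hdeg o hxy t s hs) x y).trans_eq ?_
  ring
end
end

section
/- Let G be a finite connected vertex-transitive graph of degree Δ on n vertices and let P_lazy be the transition matrix of the lazy simple random walk on G (a symmetric matrix, since G is regular). For a nonempty subset A of the vertices, let λ₁(P_A) denote the largest eigenvalue of the principal submatrix of P_lazy with rows and columns indexed by A. Then for every s ∈ (0, 1/2] and every nonempty A with |A| ≤ s·n, one has 1 − λ₁(P_A) ≥ 1/(2·Δ·V^{-1}(2ns)²), where V^{-1}(x) = min{r ∈ ℤ_{≥0} : V(r) ≥ x}. -/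
open Filter

noncomputable section

/-- Largest eigenvalue of a square real matrix, as the supremum of its real eigenvalues. -/
noncomputable def largestEigenvalue {n : Type*} [Fintype n] (M : Matrix n n ℝ) : ℝ :=
  sSup {μ : ℝ | ∃ v : n → ℝ, v ≠ 0 ∧ M.mulVec v = μ • v}

/-- `V⁻¹(x)`: the least radius `r ∈ ℤ_{≥0}` such that the ball of radius `r` around `o`
contains at least `x` vertices. -/
noncomputable def ballInv {V : Type*} (G : SimpleGraph V) (o : V) (x : ℝ) : ℕ :=
  sInf {r : ℕ | x ≤ (Nat.card {y : V | G.dist o y ≤ r} : ℝ)}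

open Finset

/-- Graph isomorphisms preserve the graph distance. -/
lemma SimpleGraph.Iso.dist_map_eq {V W : Type*} {G : SimpleGraph V} {H : SimpleGraph W}
    (hG : G.Connected) (φ : G ≃g H) (x y : V) : H.dist (φ x) (φ y) = G.dist x y := by
  have hH : H.Connected := φ.connected_iff.mp hG
  apply le_antisymm
  · obtain ⟨p, hp⟩ := hG.exists_walk_length_eq_dist x y
    simpa [← hp] using SimpleGraph.dist_le (p.map φ.toHom)
  · obtain ⟨p, hp⟩ := hH.exists_walk_length_eq_dist (φ x) (φ y)
    have := SimpleGraph.dist_le ((p.map φ.symm.toHom).copy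
      (u' := x) (v' := y) (φ.symm_apply_apply x) (φ.symm_apply_apply y))
    simpa [← hp] using this

/-- In a connected graph, every vertex at positive distance from `o` has a neighbour that is one
step closer to `o`. -/
lemma SimpleGraph.Connected.exists_adj_dist_add_one {V : Type*} {G : SimpleGraph V}
    (hG : G.Connected) {o y : V} {k : ℕ} (h : G.dist o y = k + 1) :
    ∃ z, G.Adj z y ∧ G.dist o z = k := by
  obtain ⟨p, hp⟩ := hG.exists_walk_length_eq_dist y o
  rw [SimpleGraph.dist_comm, h] at hp
  cases p with
  | nil => simp at hp
  | @cons _ z _ hz q =>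
    refine ⟨z, hz.symm, le_antisymm ?_ ?_⟩
    · rw [SimpleGraph.dist_comm]
      refine (SimpleGraph.dist_le q).trans ?_
      simpa using hp.le
    · have := hG.dist_triangle (u := o) (v := z) (w := y)
      rw [h, SimpleGraph.dist_eq_one_iff_adj.mpr hz.symm] at this
      omega

/-- Suppose `u` stretches the edges `{x, τ x}` by at most `m + ε` and all other edges by at most
`m - ε`. Since a geodesic never uses two consecutive edges `{x, τ x}`, the stretch along a geodesic
of length `k` is at most `k m + ε`, and at most `k m` unless the last edge is of that kind. -/
lemma dist_le_of_matching {V E : Type*} [PseudoMetricSpace E] {G : SimpleGraph V}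
    (hG : G.Connected) (u : V → E) (τ : V → V) (hτ : Function.Involutive τ) {m ε : ℝ}
    (hε : 0 ≤ ε) (hm : ∀ x y, G.Adj x y → dist (u x) (u y) ≤ m + ε)
    (hm' : ∀ x y, G.Adj x y → y ≠ τ x → dist (u x) (u y) ≤ m - ε) (o y : V) :
    dist (u o) (u y) ≤ G.dist o y * m + ε ∧
      (G.dist o y * m < dist (u o) (u y) → G.dist o (τ y) + 1 = G.dist o y) := by
  induction hk : G.dist o y generalizing y with
  | zero =>
    obtain rfl := hG.dist_eq_zero_iff.mp hk
    simpa using hε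
  | succ k ih =>
    obtain ⟨z, hzy, hz⟩ := hG.exists_adj_dist_add_one hk
    obtain ⟨h1, h2⟩ := ih z hz
    have htri := dist_triangle (u o) (u z) (u y)
    push_cast
    by_cases hyz : y = τ z
    · have hty : τ y = z := by rw [hyz, hτ z]
      have hgood : dist (u o) (u z) ≤ k * m := by
        by_contra! hlt
        have := h2 hlt
        rw [← hyz] at this
        omega
      have := hm z y hzy
      exact ⟨by linarith, fun _ => by rw [hty, hz]⟩
    · have := hm' z y hzy hyz
      exact ⟨by linarith, fun h => by linarith⟩

/-- The sum of squared stretches over a ball, for a map as in `dist_le_of_matching`. -/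
lemma sum_ball_dist_sq_le_of_matching {V E : Type*} [Fintype V] [PseudoMetricSpace E]
    {G : SimpleGraph V} (hG : G.Connected) (u : V → E) (τ : V → V) (hτ : Function.Involutive τ)
    {m ε : ℝ} (hε : 0 ≤ ε) (hm : ∀ x y, G.Adj x y → dist (u x) (u y) ≤ m + ε)
    (hm' : ∀ x y, G.Adj x y → y ≠ τ x → dist (u x) (u y) ≤ m - ε) (o : V) (R : ℕ) :
    ∑ y with G.dist o y ≤ R, dist (u o) (u y) ^ 2 ≤
      #{y | G.dist o y ≤ R} * ((R : ℝ) ^ 2 * (m ^ 2 + ε ^ 2)) := by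
  classical
  have key := dist_le_of_matching hG u τ hτ hε hm hm' o
  set B : Finset V := {y | G.dist o y ≤ R}
  set S : Finset V := {y ∈ B | G.dist o y * m < dist (u o) (u y)}
  set T : Finset V := S.image τ
  have hTB : ∀ y ∈ T, y ∈ B ∧ G.dist o y + 1 ≤ R := by
    intro y hy
    obtain ⟨z, hz, rfl⟩ := Finset.mem_image.mp hy
    simp only [S, B, Finset.mem_filter, Finset.mem_univ, true_and] at hz ⊢
    have := (key z).2 hz.2
    omega
  have hcard : #T = #S := Finset.card_image_of_injective _ hτ.injective
  have hpt : ∀ y ∈ B, dist (u o) (u y) ^ 2 ≤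
      ((G.dist o y : ℝ) ^ 2 + if y ∈ S then 1 else 0) * (m ^ 2 + ε ^ 2) := by
    intro y hy
    split_ifs with hS
    · have h1 := pow_le_pow_left₀ dist_nonneg (key y).1 2
      nlinarith [sq_nonneg (m - G.dist o y * ε)]
    · have h1 : dist (u o) (u y) ≤ G.dist o y * m := by
        by_contra! hlt
        exact hS (by simp [S, hy, hlt])
      have h2 := pow_le_pow_left₀ dist_nonneg h1 2
      nlinarith [mul_nonneg (sq_nonneg (G.dist o y : ℝ)) (sq_nonneg ε)]
  have hTS : ∑ y ∈ B, (if y ∈ S then (1 : ℝ) else 0) = ∑ y ∈ B, if y ∈ T then (1 : ℝ) else 0 := by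
    rw [← Finset.sum_filter, ← Finset.sum_filter]
    simp only [Finset.sum_const, nsmul_eq_mul, mul_one]
    rw [Finset.filter_mem_eq_inter, Finset.filter_mem_eq_inter,
      Finset.inter_eq_right.mpr (Finset.filter_subset _ _),
      Finset.inter_eq_right.mpr fun y hy => (hTB y hy).1, hcard]
  calc ∑ y ∈ B, dist (u o) (u y) ^ 2
      ≤ ∑ y ∈ B, ((G.dist o y : ℝ) ^ 2 + if y ∈ S then 1 else 0) * (m ^ 2 + ε ^ 2) :=
        Finset.sum_le_sum hpt
    _ = (∑ y ∈ B, ((G.dist o y : ℝ) ^ 2 + if y ∈ T then 1 else 0)) * (m ^ 2 + ε ^ 2) := by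
        rw [← Finset.sum_mul, Finset.sum_add_distrib, Finset.sum_add_distrib, hTS]
    _ ≤ (∑ y ∈ B, (R : ℝ) ^ 2) * (m ^ 2 + ε ^ 2) := by
        gcongr with y hy
        split_ifs with hT
        · have h1 : (G.dist o y : ℝ) + 1 ≤ R := by exact_mod_cast (hTB y hT).2
          have h0 : (0 : ℝ) ≤ G.dist o y := by positivity
          nlinarith
        · have h1 : (G.dist o y : ℝ) ≤ R := by exact_mod_cast (Finset.mem_filter.mp hy).2
          rw [add_zero]
          gcongr
    _ = #B * ((R : ℝ) ^ 2 * (m ^ 2 + ε ^ 2)) := by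
        rw [Finset.sum_const, nsmul_eq_mul]
        ring

/-- On a vertex-transitive graph, the sum over a ball of the squared stretches of a map with
invariant stretch is controlled by the sum over the neighbours of the centre. -/
lemma sum_ball_dist_sq_le {V E : Type*} [Fintype V] [PseudoMetricSpace E]
    {G : SimpleGraph V} [DecidableRel G.Adj] (hG : G.Connected) (htrans : IsVertexTransitive G)
    (u : V → E) (hu : ∀ (φ : G ≃g G) x y, dist (u (φ x)) (u (φ y)) = dist (u x) (u y))
    (o : V) (R : ℕ) :
    ∑ y with G.dist o y ≤ R, dist (u o) (u y) ^ 2 ≤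
      #{y | G.dist o y ≤ R} * ((R : ℝ) ^ 2 * ((∑ y with G.Adj o y, dist (u o) (u y) ^ 2) / 2)) := by
  classical
  set D : ℝ := ∑ y with G.Adj o y, dist (u o) (u y) ^ 2
  have hD0 : 0 ≤ D := Finset.sum_nonneg fun _ _ => sq_nonneg _
  have htoO : ∀ x y, G.Adj x y → ∃ z, G.Adj o z ∧ dist (u o) (u z) = dist (u x) (u y) := by
    intro x y hxy
    obtain ⟨φ, hφ⟩ := htrans x o
    exact ⟨φ y, hφ ▸ φ.map_adj_iff.mpr hxy, by rw [← hφ, hu]⟩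
  by_cases hdom : ∃ z, G.Adj o z ∧ D / 2 < dist (u o) (u z) ^ 2
  · obtain ⟨w, how, hw⟩ := hdom
    set α := dist (u o) (u w) with hα
    have hα0 : 0 ≤ α := dist_nonneg
    have hαD : α ^ 2 ≤ D :=
      Finset.single_le_sum (f := fun y => dist (u o) (u y) ^ 2)
        (fun _ _ => sq_nonneg _) (by simpa using how)
    set β := √(D - α ^ 2)
    have hβ2 : β ^ 2 = D - α ^ 2 := Real.sq_sqrt (by linarith)
    have hβ0 : 0 ≤ β := Real.sqrt_nonneg _
    have hβα : β < α := lt_of_pow_lt_pow_left₀ 2 hα0 (by linarith)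
    choose ψ hψ using fun x => htrans o x
    have hadj : ∀ x, G.Adj x (ψ x w) := by
      intro x
      have := (ψ x).map_adj_iff.mpr how
      rwa [hψ] at this
    have hατ : ∀ x, dist (u x) (u (ψ x w)) = α := by
      intro x
      have := hu (ψ x) o w
      rwa [hψ] at this
    have hother : ∀ x y, G.Adj x y → y ≠ ψ x w → dist (u x) (u y) ≤ β := by
      intro x y hxy hne
      set z := (ψ x).symm y
      have hzy : ψ x z = y := (ψ x).apply_symm_apply y
      have hoz : G.Adj o z := by
        rw [← (ψ x).map_adj_iff, hψ, hzy]
        exact hxy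
      have hdz : dist (u x) (u y) = dist (u o) (u z) := by
        rw [← hu (ψ x) o z, hψ, hzy]
      have hzw : w ≠ z := by
        intro h
        exact hne (by rw [h, hzy])
      have hsum : α ^ 2 + dist (u o) (u z) ^ 2 ≤ D := by
        rw [hα, ← Finset.sum_pair (f := fun y => dist (u o) (u y) ^ 2) hzw]
        refine Finset.sum_le_sum_of_subset_of_nonneg ?_ fun _ _ _ => sq_nonneg _
        intro a ha
        rcases Finset.mem_insert.mp ha with rfl | ha
        · simpa using how
        · rw [Finset.mem_singleton.mp ha]
          simpa using hoz
      rw [hdz]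
      exact Real.le_sqrt_of_sq_le (by linarith)
    have hinv : Function.Involutive fun x => ψ x w := by
      intro x
      by_contra hne
      have h1 := hother (ψ x w) x (hadj x).symm (Ne.symm hne)
      rw [dist_comm, hατ] at h1
      linarith
    have hmain := sum_ball_dist_sq_le_of_matching hG u _ hinv (m := (α + β) / 2)
      (ε := (α - β) / 2) (by linarith) (fun x y hxy => ?_) (fun x y hxy hne => ?_) o R
    · have : ((α + β) / 2) ^ 2 + ((α - β) / 2) ^ 2 = D / 2 := by linarith
      rwa [this] at hmain
    · by_cases hne : y = ψ x w
      · rw [hne, hατ]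
        linarith
      · linarith [hother x y hxy hne]
    · linarith [hother x y hxy hne]
  · push Not at hdom
    have hedge : ∀ x y, G.Adj x y → dist (u x) (u y) ≤ √(D / 2) := by
      intro x y hxy
      obtain ⟨z, hz, hd⟩ := htoO x y hxy
      rw [← hd]
      exact Real.le_sqrt_of_sq_le (hdom z hz)
    have hmain := sum_ball_dist_sq_le_of_matching hG u id (fun _ => rfl) (m := √(D / 2))
      (ε := 0) le_rfl (by simpa using hedge) (fun x y hxy _ => by simpa using hedge x y hxy) o R
    rwa [Real.sq_sqrt (by linarith), zero_pow two_ne_zero, add_zero] at hmain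

/-- On a vertex-transitive graph, the number of vertices related to a given vertex by an invariant
relation, and the corresponding sum of an invariant function, do not depend on the vertex. -/
lemma sum_filter_eq_of_invariant {V : Type*} [Fintype V] {G : SimpleGraph V}
    (htrans : IsVertexTransitive G) (r : V → V → Prop) [DecidableRel r]
    (hr : ∀ (φ : G ≃g G) x y, r (φ x) (φ y) ↔ r x y) (F : V → V → ℝ)
    (hF : ∀ (φ : G ≃g G) x y, F (φ x) (φ y) = F x y) (x o : V) :
    ∑ y with r x y, F x y = ∑ y with r o y, F o y := by
  obtain ⟨φ, rfl⟩ := htrans o x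
  rw [Finset.sum_filter, Finset.sum_filter, ← φ.toEquiv.sum_comp]
  refine Finset.sum_congr rfl fun y _ => ?_
  change (if r (φ o) (φ y) then F (φ o) (φ y) else 0) = _
  simp only [hr, hF]

/-- Poincaré inequality on balls of a finite vertex-transitive graph. -/
theorem poincare_ball_le {V : Type*} [Fintype V] {G : SimpleGraph V} [DecidableRel G.Adj]
    (hG : G.Connected) (htrans : IsVertexTransitive G) (f : V → ℝ) (o : V) (R : ℕ) :
    ∑ x, ∑ y with G.dist x y ≤ R, (f x - f y) ^ 2 ≤
      #{y | G.dist o y ≤ R} * ((R : ℝ) ^ 2 * ((∑ x, ∑ y with G.Adj x y, (f x - f y) ^ 2) / 2)) := by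
  classical
  have : Finite (G ≃g G) := DFunLike.finite _
  have : Fintype (G ≃g G) := Fintype.ofFinite _
  let u : V → EuclideanSpace ℝ (G ≃g G) := fun x => WithLp.toLp 2 fun φ => f (φ x)
  have hdist : ∀ x y, dist (u x) (u y) ^ 2 = ∑ φ : G ≃g G, (f (φ x) - f (φ y)) ^ 2 := by
    intro x y
    rw [EuclideanSpace.dist_sq_eq]
    simp [u, Real.dist_eq, sq_abs]
  have hu : ∀ (ψ : G ≃g G) x y, dist (u (ψ x)) (u (ψ y)) = dist (u x) (u y) := by
    intro ψ x y
    rw [← sq_eq_sq₀ dist_nonneg dist_nonneg, hdist, hdist]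
    exact Equiv.sum_comp (Equiv.mulRight ψ) fun φ : G ≃g G => (f (φ x) - f (φ y)) ^ 2
  have htotal : ∀ (r : V → V → Prop) [DecidableRel r],
      (∀ (φ : G ≃g G) x y, r (φ x) (φ y) ↔ r x y) →
      ∑ x, ∑ y with r x y, dist (u x) (u y) ^ 2 =
        Fintype.card (G ≃g G) * ∑ x, ∑ y with r x y, (f x - f y) ^ 2 := by
    intro r _ hr
    simp only [Finset.sum_filter, hdist]
    have hφ : ∀ φ : G ≃g G, ∑ x, ∑ y, (if r x y then (f (φ x) - f (φ y)) ^ 2 else 0) =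
        ∑ x, ∑ y, if r x y then (f x - f y) ^ 2 else 0 := by
      intro φ
      rw [← φ.toEquiv.sum_comp fun x => ∑ y, if r x y then (f x - f y) ^ 2 else 0]
      refine Finset.sum_congr rfl fun x _ => ?_
      rw [← φ.toEquiv.sum_comp fun y =>
        if r (φ.toEquiv x) y then (f (φ.toEquiv x) - f y) ^ 2 else 0]
      refine Finset.sum_congr rfl fun y _ => ?_
      change _ = if r (φ x) (φ y) then (f (φ x) - f (φ y)) ^ 2 else 0
      simp only [hr]
    calc ∑ x, ∑ y, (if r x y then ∑ φ : G ≃g G, (f (φ x) - f (φ y)) ^ 2 else 0)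
        = ∑ x, ∑ y, ∑ φ : G ≃g G, (if r x y then (f (φ x) - f (φ y)) ^ 2 else 0) := by
          refine Finset.sum_congr rfl fun x _ => Finset.sum_congr rfl fun y _ => ?_
          split_ifs <;> simp
      _ = ∑ φ : G ≃g G, ∑ x, ∑ y, (if r x y then (f (φ x) - f (φ y)) ^ 2 else 0) := by
          rw [Finset.sum_comm (s := univ (α := G ≃g G))]
          exact Finset.sum_congr rfl fun x _ => Finset.sum_comm
      _ = _ := by simp [hφ]
  have hball : ∀ (φ : G ≃g G) x y, G.dist (φ x) (φ y) ≤ R ↔ G.dist x y ≤ R :=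
    fun φ x y => by rw [φ.dist_map_eq hG]
  have hcard : ∀ x, (#{y | G.dist x y ≤ R} : ℝ) = #{y | G.dist o y ≤ R} := by
    intro x
    simpa using sum_filter_eq_of_invariant htrans (fun x y => G.dist x y ≤ R) hball
      (fun _ _ => 1) (fun _ _ _ => rfl) x o
  have hpos : (0 : ℝ) < Fintype.card (G ≃g G) := by
    exact_mod_cast Fintype.card_pos_iff.mpr ⟨SimpleGraph.Iso.refl⟩
  have hsum := Finset.sum_le_sum fun x (_ : x ∈ univ) => sum_ball_dist_sq_le hG htrans u hu x R
  simp only [hcard] at hsum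
  rw [← Finset.mul_sum, ← Finset.mul_sum, ← Finset.sum_div, htotal _ hball,
    htotal _ fun φ x y => φ.map_adj_iff] at hsum
  refine le_of_mul_le_mul_left (hsum.trans_eq ?_) hpos
  ring

/-- Expansion of a Dirichlet form with symmetric `0`-`1` weights and constant row sums. -/
lemma sum_sum_filter_sub_sq {V : Type*} [Fintype V] (r : V → V → Prop) [DecidableRel r]
    (hr : ∀ x y, r x y ↔ r y x) {N : ℝ} (hN : ∀ x, (#{y | r x y} : ℝ) = N) (f : V → ℝ) :
    ∑ x, ∑ y with r x y, (f x - f y) ^ 2 =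
      2 * N * ∑ x, f x ^ 2 - 2 * ∑ x, ∑ y with r x y, f x * f y := by
  have h1 : ∑ x, ∑ y with r x y, f x ^ 2 = N * ∑ x, f x ^ 2 := by
    simp [Finset.mul_sum, hN]
  have h2 : ∑ x, ∑ y with r x y, f y ^ 2 = N * ∑ x, f x ^ 2 := by
    rw [← h1]
    simp only [Finset.sum_filter]
    rw [Finset.sum_comm]
    simp only [hr]
  have h3 : ∀ x y, (f x - f y) ^ 2 = f x ^ 2 + f y ^ 2 - 2 * (f x * f y) := fun x y => by ring
  simp only [h3, Finset.sum_sub_distrib, Finset.sum_add_distrib, h1, h2, ← Finset.mul_sum]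
  ring

/-- Faber–Krahn type inequality for functions supported on a set that fills at most half of a
ball. -/
theorem sum_sq_le_dirichlet {V : Type*} [Fintype V] {G : SimpleGraph V} [DecidableRel G.Adj]
    (hG : G.Connected) (htrans : IsVertexTransitive G) (f : V → ℝ) (A : Finset V)
    (hf : ∀ x ∉ A, f x = 0) (o : V) (R : ℕ)
    (hAR : 2 * (#A : ℝ) ≤ #{y | G.dist o y ≤ R}) :
    ∑ x, f x ^ 2 ≤ (R : ℝ) ^ 2 * ((∑ x, ∑ y with G.Adj x y, (f x - f y) ^ 2) / 2) := by
  have hcard : ∀ x, (#{y | G.dist x y ≤ R} : ℝ) = #{y | G.dist o y ≤ R} := by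
    intro x
    simpa using sum_filter_eq_of_invariant htrans (fun x y => G.dist x y ≤ R)
      (fun φ x y => by rw [φ.dist_map_eq hG]) (fun _ _ => 1) (fun _ _ _ => rfl) x o
  have hpoin := poincare_ball_le hG htrans f o R
  rw [sum_sum_filter_sub_sq _ (fun x y => by rw [SimpleGraph.dist_comm]) hcard] at hpoin
  have hcross : ∑ x, ∑ y with G.dist x y ≤ R, f x * f y ≤ #A * ∑ x, f x ^ 2 := by
    calc ∑ x, ∑ y with G.dist x y ≤ R, f x * f y
        ≤ ∑ x, ∑ y with G.dist x y ≤ R, |f x| * |f y| := by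
          refine Finset.sum_le_sum fun x _ => Finset.sum_le_sum fun y _ => ?_
          rw [← abs_mul]
          exact le_abs_self _
      _ ≤ ∑ x, ∑ y, |f x| * |f y| := by
          gcongr with x _
          exact Finset.filter_subset _ _
      _ = (∑ x ∈ A, |f x|) ^ 2 := by
          rw [← Finset.sum_mul_sum, ← sq,
            Finset.sum_subset (Finset.subset_univ A) fun x _ hx => by simp [hf x hx]]
      _ ≤ #A * ∑ x ∈ A, |f x| ^ 2 := sq_sum_le_card_mul_sum_sq
      _ = #A * ∑ x, f x ^ 2 := by
          simp only [sq_abs]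
          rw [Finset.sum_subset (Finset.subset_univ A) fun x _ hx => by simp [hf x hx]]
  have hV : (0 : ℝ) < #{y | G.dist o y ≤ R} := by
    exact_mod_cast Finset.card_pos.mpr ⟨o, by simp⟩
  have hF : 0 ≤ ∑ x, f x ^ 2 := Finset.sum_nonneg fun _ _ => sq_nonneg _
  refine le_of_mul_le_mul_left (le_trans ?_ hpoin) hV
  nlinarith

/-- The quadratic form of the lazy walk on a regular graph in terms of the Dirichlet form. -/
lemma sum_mul_lazyMatrix_mulVec {V : Type*} [Fintype V] [DecidableEq V] {G : SimpleGraph V}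
    [DecidableRel G.Adj] {Δ : ℕ} (hΔ : Δ ≠ 0) (hreg : ∀ x, G.degree x = Δ) (f : V → ℝ) :
    ∑ x, f x * ∑ y, lazyMatrix (srwMatrix G) x y * f y =
      ∑ x, f x ^ 2 - (∑ x, ∑ y with G.Adj x y, (f x - f y) ^ 2) / (4 * Δ) := by
  have hdeg : ∀ x, (#{y | G.Adj x y} : ℝ) = Δ := by
    intro x
    rw [← hreg x, ← SimpleGraph.card_neighborFinset_eq_degree,
      SimpleGraph.neighborFinset_eq_filter]
  have hrow : ∀ x, f x * ∑ y, lazyMatrix (srwMatrix G) x y * f y =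
      f x ^ 2 / 2 + (∑ y with G.Adj x y, f x * f y) / (2 * Δ) := by
    intro x
    have : ∀ y, lazyMatrix (srwMatrix G) x y * f y =
        (if x = y then f y / 2 else 0) + (if G.Adj x y then f y else 0) / (2 * Δ) := by
      intro y
      simp only [lazyMatrix, srwMatrix, Matrix.smul_apply, Matrix.add_apply, Matrix.one_apply,
        smul_eq_mul, hreg]
      split_ifs <;> field_simp <;> ring
    simp only [this, Finset.sum_add_distrib, ← Finset.sum_div, Finset.sum_ite_eq,
      Finset.mem_univ, if_true, ← Finset.mul_sum, ← Finset.sum_filter (G.Adj x)]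
    ring
  simp only [hrow, Finset.sum_add_distrib, ← Finset.sum_div]
  rw [sum_sum_filter_sub_sq _ (fun x y => G.adj_comm x y) hdeg]
  have : (Δ : ℝ) ≠ 0 := by exact_mod_cast hΔ
  field_simp
  ring

/-- The defining property of `ballInv` at values that some ball attains. -/
lemma le_card_ball_ballInv {V : Type*} [Fintype V] (G : SimpleGraph V) (o : V) {x : ℝ}
    (hx : x ≤ Fintype.card V) : x ≤ #{y | G.dist o y ≤ ballInv G o x} := by
  have hmem : ballInv G o x ∈ {r : ℕ | x ≤ (Nat.card {y : V | G.dist o y ≤ r} : ℝ)} := by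
    refine Nat.sInf_mem ⟨univ.sup (G.dist o), ?_⟩
    have : {y : V | G.dist o y ≤ univ.sup (G.dist o)} = Set.univ :=
      Set.eq_univ_of_forall fun y => Finset.le_sup (f := G.dist o) (Finset.mem_univ y)
    rw [Set.mem_ofPred_eq, this, Nat.card_univ, Nat.card_eq_fintype_card]
    exact hx
  have hcard : ∀ r, Nat.card {y : V | G.dist o y ≤ r} = #{y | G.dist o y ≤ r} := by
    intro r
    rw [Nat.card_coe_set_eq, ← Set.ncard_coe_finset]
    simp
  simpa only [Set.mem_ofPred_eq, hcard] using hmem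

/-- Lower bound on the spectral gap of killed lazy walks on
vertex-transitive graphs: for `A` with `|A| ≤ s·n`,
`1 − λ₁(P_A) ≥ 1/(2·Δ·V⁻¹(2ns)²)`. -/
theorem stmt17 (Δ : ℕ) (V : Type) [Fintype V] [DecidableEq V]
    (G : SimpleGraph V) [DecidableRel G.Adj]
    (hconn : G.Connected) (htrans : IsVertexTransitive G)
    (hreg : ∀ x, G.degree x = Δ)
    (s : ℝ) (hs : s ∈ Set.Ioc (0 : ℝ) (1/2))
    (A : Finset V) (hA : A.Nonempty) (hAcard : (A.card : ℝ) ≤ s * Fintype.card V)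
    (o : V) :
    1 / (2 * (Δ : ℝ) * (ballInv G o (2 * Fintype.card V * s) : ℝ) ^ 2) ≤
      1 - largestEigenvalue
        (Matrix.of fun i j : A => lazyMatrix (srwMatrix G) (i : V) (j : V)) := by
  set R := ballInv G o (2 * Fintype.card V * s)
  have hA1 : (1 : ℝ) ≤ #A := by exact_mod_cast hA.card_pos
  have hn : (0 : ℝ) ≤ Fintype.card V := by positivity
  have hΔ : Δ ≠ 0 := by
    have hcard : 1 < Fintype.card V := by
      have : (1 : ℝ) < Fintype.card V := by nlinarith [hs.2]
      exact_mod_cast this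
    have := Fintype.one_lt_card_iff_nontrivial.mp hcard
    rw [← hreg o]
    exact (hconn.preconnected.degree_pos_of_nontrivial o).ne'
  have hAR : 2 * (#A : ℝ) ≤ #{y | G.dist o y ≤ R} := by
    refine le_trans ?_ (le_card_ball_ballInv G o (x := 2 * Fintype.card V * s) ?_)
    · linarith
    · nlinarith [hs.2]
  rw [le_sub_comm]
  refine Real.sSup_le ?_ ?_
  · rintro μ ⟨v, hv, hμ⟩
    set f : V → ℝ := fun x => if hx : x ∈ A then v ⟨x, hx⟩ else 0 with hf
    have hfA : ∀ i : A, f i = v i := fun i => by simp [hf]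
    have hf0 : ∀ x ∉ A, f x = 0 := fun x hx => by simp [hf, hx]
    have hsumA : ∀ g : V → ℝ, (∀ x ∉ A, g x = 0) → ∑ x, g x = ∑ i : A, g i := by
      intro g hg
      rw [Finset.sum_coe_sort A g]
      exact (Finset.sum_subset (Finset.subset_univ A) fun x _ hx => hg x hx).symm
    have hquad : ∑ x, f x * ∑ y, lazyMatrix (srwMatrix G) x y * f y = μ * ∑ x, f x ^ 2 := by
      rw [hsumA _ fun x hx => by simp [hf0 x hx], hsumA _ fun x hx => by simp [hf0 x hx],
        Finset.mul_sum]
      refine Finset.sum_congr rfl fun i _ => ?_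
      rw [hsumA _ fun x hx => by simp [hf0 x hx]]
      have := congrFun hμ i
      simp only [Matrix.mulVec, dotProduct, Matrix.of_apply, Pi.smul_apply, smul_eq_mul] at this
      simp only [hfA, this]
      ring
    have hFpos : 0 < ∑ x, f x ^ 2 := by
      obtain ⟨i, hi⟩ := Function.ne_iff.mp hv
      refine Finset.sum_pos' (fun _ _ => sq_nonneg _) ⟨i, Finset.mem_univ _, ?_⟩
      rw [hfA]
      exact sq_pos_of_ne_zero hi
    rw [sum_mul_lazyMatrix_mulVec hΔ hreg] at hquad
    have hFK := sum_sq_le_dirichlet hconn htrans f A hf0 o R hAR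
    have hΔpos : (0 : ℝ) < Δ := by exact_mod_cast Nat.pos_of_ne_zero hΔ
    have hRpos : (0 : ℝ) < (R : ℝ) ^ 2 := by
      refine lt_of_le_of_ne (by positivity) fun h => ?_
      rw [← h] at hFK
      linarith
    set D := ∑ x, ∑ y with G.Adj x y, (f x - f y) ^ 2
    refine le_of_mul_le_mul_right ?_ hFpos
    rw [← hquad, sub_mul, one_mul]
    apply sub_le_sub_left
    rw [div_mul_eq_mul_div, one_mul, div_le_div_iff₀ (by positivity) (by positivity)]
    nlinarith
  · have : (1 : ℝ) / (2 * Δ * (R : ℝ) ^ 2) ≤ 1 := by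
      have := Nat.cast_inv_le_one (α := ℝ) (2 * Δ * R ^ 2)
      push_cast at this
      rwa [one_div]
    linarith
end
end
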